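/- arXiv:math/0005285 — 3 statements merged into one kernel-verified Lean document; each statement's English description precedes it below -/
import Mathlib

section
/- Let R : ℂ^d → B(K) be a Clifford structure of dimension d on a complex Hilbert space K and let Γ : 𝕋 → B(K) be its gauge group. Every operator A ∈ B(K) satisfying R(z)A + AR(z) = 0 for every z ∈ ℂ^d admits a decomposition A = A₀Γ(−1), where A₀ belongs to the commutant of the C*-algebra generated by R(ℂ^d). In particular, such an operator is gauge invariant: Γ(λ)AΓ(λ)* = A for all λ ∈ 𝕋. -/
noncomputable section
open ContinuousLinearMap

section DiracDefs

variable {K : Type*} [NormedAddCommGroup K] [InnerProductSpace ℂ K] [CompleteSpace K]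

/-- `-1` as an element of the circle group. -/
def negOne : Circle := ⟨-1, by simp [Submonoid.unitSphere]⟩

/-- A Clifford structure of dimension `d`. -/
def IsCliffordStructure {d : ℕ} (R : EuclideanSpace ℂ (Fin d) → K →L[ℂ] K) : Prop :=
  (∀ z w, R (z + w) = R z + R w) ∧
  (∀ (c : ℝ) (z), R (c • z) = c • R z) ∧
  (∀ z, IsSelfAdjoint (R z)) ∧
  (∀ z, R z * R z = ((‖z‖ : ℂ) ^ 2) • 1)

/-- The C*-algebra generated by the range of `R`. -/
def cliffordAlgebraOf {d : ℕ} (R : EuclideanSpace ℂ (Fin d) → K →L[ℂ] K) :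
    StarSubalgebra ℂ (K →L[ℂ] K) :=
  (StarAlgebra.adjoin ℂ (Set.range R)).topologicalClosure

/-- Spectral subspace `K_n = {ξ : Γ(λ)ξ = λⁿ ξ}` of a circle representation. -/
def specSub (Γ : Circle → K →L[ℂ] K) (n : ℤ) : Set K :=
  {ξ | ∀ u : Circle, Γ u ξ = (((u ^ n : Circle) : ℂ)) • ξ}

/-- A strongly continuous unitary representation of the circle group. -/
def IsUnitaryRep (Γ : Circle → K →L[ℂ] K) : Prop :=
  (∀ u v, Γ (u * v) = Γ u * Γ v) ∧ (Γ 1 = 1) ∧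
  (∀ u, ContinuousLinearMap.adjoint (Γ u) = Γ u⁻¹) ∧
  (∀ ξ : K, Continuous fun u : Circle => Γ u ξ)

/-- The gauge group of a Clifford structure `R`. -/
def IsGaugeGroup {d : ℕ} (R : EuclideanSpace ℂ (Fin d) → K →L[ℂ] K)
    (Γ : Circle → K →L[ℂ] K) : Prop :=
  IsUnitaryRep Γ ∧
  (∀ u, Γ u ∈ cliffordAlgebraOf R) ∧
  (∀ u z, Γ u * R z * ContinuousLinearMap.adjoint (Γ u) = R ((u : ℂ) • z)) ∧
  (∀ n : ℤ, n < 0 → specSub Γ n = {0}) ∧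
  specSub Γ 0 ≠ {0}

/-- A Dirac operator of dimension `d` (conditions (D1), (D2), (D3)). -/
def IsDiracOperator {d : ℕ} (D : K →L[ℂ] K)
    (R : EuclideanSpace ℂ (Fin d) → K →L[ℂ] K) : Prop :=
  IsSelfAdjoint D ∧ IsCliffordStructure R ∧
  ∃ Γ : Circle → K →L[ℂ] K, IsGaugeGroup R Γ ∧
    (Γ negOne * D * ContinuousLinearMap.adjoint (Γ negOne) = -D) ∧
    (∀ u, Γ u * (D * D) * ContinuousLinearMap.adjoint (Γ u) = D * D) ∧
    (∀ z, ∀ a ∈ cliffordAlgebraOf R, (R z * D + D * R z) * a = a * (R z * D + D * R z))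

end DiracDefs

/-- An operator commuting with every element of a set of self-adjoint operators commutes with
the norm-closed star algebra generated by that set. -/
theorem commute_of_mem_topologicalClosure_adjoin {K : Type*} [NormedAddCommGroup K]
    [InnerProductSpace ℂ K] [CompleteSpace K] {S : Set (K →L[ℂ] K)}
    (hS : ∀ a ∈ S, IsSelfAdjoint a) {B : K →L[ℂ] K} (hB : ∀ a ∈ S, Commute B a)
    {a : K →L[ℂ] K} (ha : a ∈ (StarAlgebra.adjoin ℂ S).topologicalClosure) : Commute B a := by
  have hclosed : IsClosed {a : K →L[ℂ] K | B * a = a * B} :=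
    isClosed_eq (continuous_const.mul continuous_id) (continuous_id.mul continuous_const)
  refine closure_minimal (s := (StarAlgebra.adjoin ℂ S : Set (K →L[ℂ] K))) ?_ hclosed ha
  intro b hb
  have hb' : b ∈ Algebra.adjoin ℂ (S ∪ star S) := hb
  change Commute B b
  induction hb' using Algebra.adjoin_induction with
  | mem x hx =>
    rcases hx with hx | hx
    · exact hB x hx
    · have h := hB _ hx
      rwa [← (hS _ hx).star_eq, star_star] at h
  | algebraMap r => exact (Algebra.commutes r B).symm
  | add x y hx hy ihx ihy => exact (ihx hx).add_right (ihy hy)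
  | mul x y hx hy ihx ihy => exact (ihx hx).mul_right (ihy hy)

/-- The gauge symmetry at `-1` anticommutes with the Clifford structure. -/
theorem IsGaugeGroup.negOne_mul {d : ℕ} {K : Type*} [NormedAddCommGroup K]
    [InnerProductSpace ℂ K] [CompleteSpace K] {R : EuclideanSpace ℂ (Fin d) → K →L[ℂ] K}
    (hR : IsCliffordStructure R) {Γ : Circle → K →L[ℂ] K} (hΓ : IsGaugeGroup R Γ)
    (z : EuclideanSpace ℂ (Fin d)) : Γ negOne * R z = -(R z * Γ negOne) := by
  obtain ⟨⟨hmul, hone, hadj, -⟩, -, hcov, -, -⟩ := hΓ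
  have hneg : R (((negOne : Circle) : ℂ) • z) = -R z := by
    have h := hR.2.1 (-1) z
    rw [neg_one_smul, neg_one_smul] at h
    rw [← h]
    congr 1
    exact neg_one_smul ℂ z
  have h := hcov negOne z
  rw [hneg, hadj] at h
  calc Γ negOne * R z = Γ negOne * R z * Γ negOne⁻¹ * Γ negOne := by
        rw [mul_assoc _ (Γ negOne⁻¹), ← hmul, inv_mul_cancel, hone, mul_one]
    _ = -(R z * Γ negOne) := by rw [h, neg_mul]

/-- **Lemma.** If `A` anticommutes with every `R(z)` of a Clifford structure
with gauge group `Γ`, then `A = A₀ Γ(-1)` with `A₀` in the commutant of the C*-algebra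
generated by `R(ℂ^d)`; in particular `A` is gauge invariant. -/
theorem arveson_stmt9 {d : ℕ} {K : Type*} [NormedAddCommGroup K] [InnerProductSpace ℂ K]
    [CompleteSpace K] (R : EuclideanSpace ℂ (Fin d) → K →L[ℂ] K)
    (hR : IsCliffordStructure R) (Γ : Circle → K →L[ℂ] K) (hΓ : IsGaugeGroup R Γ)
    (A : K →L[ℂ] K) (hA : ∀ z, R z * A + A * R z = 0) :
    (∃ A₀ : K →L[ℂ] K, (∀ a ∈ cliffordAlgebraOf R, A₀ * a = a * A₀) ∧ A = A₀ * Γ negOne) ∧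
    ∀ u : Circle, Γ u * A * ContinuousLinearMap.adjoint (Γ u) = A := by
  have hanti := IsGaugeGroup.negOne_mul hR hΓ
  obtain ⟨⟨hmul, hone, hadj, -⟩, hmem, -, -, -⟩ := hΓ
  have hsq : Γ negOne * Γ negOne = 1 := by
    rw [← hmul, ← hone]
    congr 1
    ext
    change (-1 : ℂ) * -1 = 1
    norm_num
  have hcomm : ∀ a ∈ cliffordAlgebraOf R, Commute (A * Γ negOne) a := by
    intro a ha
    refine commute_of_mem_topologicalClosure_adjoin ?_ ?_ ha
    · rintro _ ⟨z, rfl⟩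
      exact hR.2.2.1 z
    · rintro _ ⟨z, rfl⟩
      change A * Γ negOne * R z = R z * (A * Γ negOne)
      rw [mul_assoc, hanti, mul_neg, ← mul_assoc, ← mul_assoc, ← neg_mul,
        eq_neg_of_add_eq_zero_left (hA z)]
  have hA₀ : A = A * Γ negOne * Γ negOne := by rw [mul_assoc, hsq, mul_one]
  refine ⟨⟨A * Γ negOne, hcomm, hA₀⟩, fun u => ?_⟩
  have hΓcomm : Commute (Γ negOne) (Γ u) := by
    change Γ negOne * Γ u = Γ u * Γ negOne
    rw [← hmul, ← hmul, mul_comm]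
  have hAu : Commute A (Γ u) := by
    rw [hA₀]
    exact (hcomm _ (hmem u)).mul_left hΓcomm
  rw [hadj, ← hAu.eq, mul_assoc, ← hmul, mul_inv_cancel, hone, mul_one]

end
end

section
/- Let (D,R) be a Dirac operator of dimension d on a complex Hilbert space H, with gauge group Γ(λ) = Σ_{n=0}^d λⁿE_n where E_n are the spectral projections onto the subspaces H_n. Then the operator B = Σ_n E_{n+1}DE_n satisfies B² = 0 and D = B + B*; moreover B maps H_n into H_{n+1} and B* maps H_n into H_{n−1}, so that 0 → H₀ → H₁ → … → H_d → 0 with coboundary B is a complex. -/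
noncomputable section
open ContinuousLinearMap

namespace CliffordWords

variable {A ι : Type*} [Ring A] {e : ι → A}

theorem prod_map_perm (hanti : ∀ i j, i ≠ j → e i * e j = -(e j * e i)) {l l' : List ι}
    (h : l.Perm l') : (l.map e).prod = (l'.map e).prod ∨ (l.map e).prod = -(l'.map e).prod := by
  induction h with
  | nil => simp
  | cons x _ ih => rcases ih with ih | ih <;> simp [ih]
  | swap x y l =>
    by_cases hxy : y = x
    · simp [hxy]
    · right
      simp only [List.map_cons, List.prod_cons, ← mul_assoc]
      rw [hanti y x hxy, neg_mul]
  | trans _ _ ih₁ ih₂ =>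
    rcases ih₁ with ih₁ | ih₁ <;> rcases ih₂ with ih₂ | ih₂ <;> simp [ih₁, ih₂]

section

variable [DecidableEq ι]

theorem mul_prod_map (hanti : ∀ i j, i ≠ j → e i * e j = -(e j * e i)) (i : ι) (l : List ι) :
    e i * (l.map e).prod = (-1) ^ (l.length + l.count i) * ((l.map e).prod * e i) := by
  induction l with
  | nil => simp
  | cons j l ih =>
    by_cases hij : i = j
    · subst hij
      have : (-1 : A) ^ (l.length + 1 + (l.count i + 1)) = (-1) ^ (l.length + l.count i) := by
        rw [show l.length + 1 + (l.count i + 1) = l.length + l.count i + 2 by ring, pow_add]; simp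
      simp only [List.map_cons, List.prod_cons, List.length_cons, List.count_cons_self, this]
      conv_lhs => rw [ih]
      rw [← mul_assoc, ((Commute.neg_one_left (e i)).pow_left _).eq.symm]
      simp only [mul_assoc]
    · have : (-1 : A) ^ (l.length + 1 + l.count i) = -(-1) ^ (l.length + l.count i) := by
        rw [show l.length + 1 + l.count i = l.length + l.count i + 1 by ring, pow_succ]; simp
      simp only [List.map_cons, List.prod_cons, List.length_cons,
        List.count_cons_of_ne (Ne.symm hij), this]
      rw [← mul_assoc, hanti i j hij, neg_mul, mul_assoc, ih, ← mul_assoc,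
        ((Commute.neg_one_left (e j)).pow_left _).eq.symm]
      simp only [mul_assoc, neg_mul]

theorem prod_map_eq_one_or (hsq : ∀ i, e i * e i = 1)
    (hanti : ∀ i j, i ≠ j → e i * e j = -(e j * e i)) (n : ℕ) :
    ∀ l : List ι, l.length ≤ n → (∀ i, Even (l.count i)) →
      (l.map e).prod = 1 ∨ (l.map e).prod = -1 := by
  induction n with
  | zero => intro l hl _; simp [List.length_eq_zero_iff.mp (Nat.le_zero.mp hl)]
  | succ n ih =>
    intro l hl hev
    cases l with
    | nil => simp
    | cons a t =>
      have hat : a ∈ t := by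
        have := hev a
        rw [List.count_cons_self] at this
        rw [← List.count_pos_iff]
        by_contra h
        rw [show t.count a = 0 by omega] at this
        exact absurd this (by decide)
      have hperm := List.perm_cons_erase hat
      have hlen := hperm.length_eq
      simp only [List.length_cons] at hlen hl
      have key := ih (t.erase a) (by omega) fun i => by
        have h1 := hev i
        have h2 := hperm.count_eq i
        rw [List.count_cons] at h1 h2
        split_ifs at h1 h2 <;> grind
      have hp := prod_map_perm hanti hperm
      simp only [List.map_cons, List.prod_cons] at hp ⊢
      rcases hp with hp | hp <;> rcases key with key | key <;> simp [hp, key, hsq]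

end

variable [Algebra ℂ A]

/-- The composition of the averages `x ↦ (x + eᵢ x eᵢ) / 2` over a list of indices. -/
def twirl (e : ι → A) : List ι → A →ₗ[ℂ] A
  | [] => LinearMap.id
  | i :: L => (1 / 2 : ℂ) • (LinearMap.id +
      LinearMap.mulLeft ℂ (e i) ∘ₗ LinearMap.mulRight ℂ (e i)) ∘ₗ twirl e L

theorem twirl_cons (e : ι → A) (i : ι) (L : List ι) (x : A) :
    twirl e (i :: L) x = (1 / 2 : ℂ) • (twirl e L x + e i * (twirl e L x * e i)) := by
  simp [twirl]

theorem continuous_twirl [TopologicalSpace A] [IsTopologicalRing A] [ContinuousConstSMul ℂ A]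
    (e : ι → A) (L : List ι) : Continuous (twirl e L) := by
  induction L with
  | nil => exact continuous_id
  | cons i L ih => simp only [funext (twirl_cons e i L)]; fun_prop

theorem half_smul_add_self (x : A) : (1 / 2 : ℂ) • (x + x) = x := by
  rw [← two_smul ℂ x, smul_smul]; norm_num

theorem twirl_eq_self {e : ι → A} (hsq : ∀ i, e i * e i = 1) {x : A}
    (hx : ∀ i, e i * x = x * e i) (L : List ι) : twirl e L x = x := by
  induction L with
  | nil => rfl
  | cons i L ih =>
    rw [twirl_cons, ih, ← mul_assoc, hx, mul_assoc, hsq, mul_one, half_smul_add_self]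

/-- A product of generators twirls to `0` unless it commutes with the generators involved. -/
theorem twirl_eq_zero_or {e : ι → A} (hsq : ∀ i, e i * e i = 1) {x : A}
    (hx : ∀ i, e i * x = x * e i ∨ e i * x = -(x * e i)) (L : List ι) :
    twirl e L x = 0 ∨ twirl e L x = x ∧ ∀ i ∈ L, e i * x = x * e i := by
  induction L with
  | nil => right; simp [twirl]
  | cons i L ih =>
    rcases ih with ih | ⟨ih, hL⟩
    · left; simp [twirl_cons, ih]
    · rcases hx i with h | h
      · right
        refine ⟨?_, by simpa [h] using hL⟩
        rw [twirl_cons, ih, ← mul_assoc, h, mul_assoc, hsq, mul_one, half_smul_add_self]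
      · left
        rw [twirl_cons, ih, ← mul_assoc, h, neg_mul, mul_assoc, hsq, mul_one, add_neg_cancel,
          smul_zero]

variable [DecidableEq ι]

/-- The centre of an algebra generated by evenly many anticommuting square roots of `1`
consists of scalars; the algebra may be completed in a topology. -/
theorem mem_span_one_of_commute [TopologicalSpace A] [IsTopologicalRing A] [T2Space A]
    [ContinuousSMul ℂ A] [Fintype ι] (hcard : Even (Fintype.card ι))
    (hsq : ∀ i, e i * e i = 1)
    (hanti : ∀ i j, i ≠ j → e i * e j = -(e j * e i)) {x : A}
    (hx : x ∈ closure (Algebra.adjoin ℂ (Set.range e) : Set A))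
    (hcomm : ∀ i, e i * x = x * e i) : ∃ c : ℂ, x = c • (1 : A) := by
  let L := (Finset.univ : Finset ι).toList
  have hword (l : List ι) : twirl e L (l.map e).prod ∈ Submodule.span ℂ {(1 : A)} := by
    have hone : (1 : A) ∈ Submodule.span ℂ {(1 : A)} := Submodule.mem_span_singleton_self 1
    have hsign (i : ι) : e i * (l.map e).prod = (l.map e).prod * e i ∨
        e i * (l.map e).prod = -((l.map e).prod * e i) := by
      rw [mul_prod_map hanti]
      rcases neg_one_pow_eq_or A (l.length + l.count i) with h | h <;> simp [h]
    rcases twirl_eq_zero_or hsq hsign L with h | ⟨h, hL⟩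
    · rw [h]; exact zero_mem _
    rw [h]
    by_cases hall : ∀ i, Even (l.length + l.count i)
    · have hev : Even l.length := by
        by_contra hodd
        have hcount (i : ι) : Odd (l.count i) := by
          have := hall i
          grind
        have hsum : ∑ i, l.count i = l.length := by
          simpa using Multiset.sum_count_eq_card (s := Finset.univ) (m := (l : Multiset ι))
        have := Finset.odd_sum_iff_odd_card_odd (s := Finset.univ) (fun i => l.count i)
        rw [hsum, Finset.filter_true_of_mem (fun i _ => hcount i), Finset.card_univ] at this
        grind
      have hcount (i : ι) : Even (l.count i) := by
        have := hall i
        grind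
      rcases prod_map_eq_one_or hsq hanti l.length l le_rfl hcount with h1 | h1
      · rw [h1]; exact hone
      · rw [h1]; exact neg_mem hone
    · push Not at hall
      obtain ⟨i, hi⟩ := hall
      have h1 := mul_prod_map hanti i l
      rw [(Nat.not_even_iff_odd.mp hi).neg_one_pow, hL i (by simp [L]), neg_one_mul] at h1
      have h2 : (l.map e).prod * e i = 0 := by
        rw [← half_smul_add_self ((l.map e).prod * e i)]
        nth_rewrite 1 [h1]
        simp
      have h3 : (l.map e).prod = 0 := by
        rw [← mul_one (l.map e).prod, ← hsq i, ← mul_assoc, h2, zero_mul]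
      rw [h3]; exact zero_mem _
  have hle : (Algebra.adjoin ℂ (Set.range e) : Set A) ⊆
      twirl e L ⁻¹' (Submodule.span ℂ {(1 : A)} : Set A) := by
    intro y hy
    have hy' : y ∈ Subalgebra.toSubmodule (Algebra.adjoin ℂ (Set.range e)) := hy
    rw [Algebra.adjoin_eq_span] at hy'
    refine (Submodule.span_le (p := (Submodule.span ℂ {(1 : A)}).comap (twirl e L))).mpr ?_ hy'
    intro w hw
    obtain ⟨l, hl, rfl⟩ := Submonoid.exists_list_of_mem_closure hw
    obtain ⟨l, rfl⟩ : ∃ m : List ι, m.map e = l := by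
      rw [← Set.mem_range, Set.range_list_map]; exact hl
    exact hword l
  have hclosed : IsClosed (twirl e L ⁻¹' (Submodule.span ℂ {(1 : A)} : Set A)) :=
    (Submodule.closed_of_finiteDimensional _).preimage (continuous_twirl e L)
  have hmem := closure_minimal hle hclosed hx
  rw [Set.mem_preimage, twirl_eq_self hsq hcomm, SetLike.mem_coe,
    Submodule.mem_span_singleton] at hmem
  obtain ⟨c, hc⟩ := hmem
  exact ⟨c, hc.symm⟩

end CliffordWords

section GaugeGroup

variable {K : Type*} [NormedAddCommGroup K] [InnerProductSpace ℂ K] [CompleteSpace K]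
  {d : ℕ} {R : EuclideanSpace ℂ (Fin d) → K →L[ℂ] K} {Γ : Circle → K →L[ℂ] K}

theorem exists_circle_zpow_ne_one : ∃ v : Circle, ∀ k : ℤ, k ≠ 0 → (v : ℂ) ^ k ≠ 1 := by
  refine ⟨Circle.exp 1, fun k hk h => ?_⟩
  rw [Circle.coe_exp, ← Complex.exp_int_mul, Complex.exp_eq_one_iff] at h
  obtain ⟨n, hn⟩ := h
  have h1 : (k : ℝ) = n * (2 * Real.pi) := by
    have := congrArg Complex.im hn
    simpa using this
  have hn0 : n ≠ 0 := by
    rintro rfl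
    simp at h1
    exact hk h1
  refine irrational_pi ⟨(k : ℚ) / (2 * n), ?_⟩
  have : (n : ℝ) ≠ 0 := by exact_mod_cast hn0
  push_cast
  field_simp
  linarith

namespace IsCliffordStructure

theorem map_ofReal_smul (hR : IsCliffordStructure R) (c : ℝ) (z : EuclideanSpace ℂ (Fin d)) :
    R ((c : ℂ) • z) = (c : ℂ) • R z := by
  have := hR.2.1 c z
  rwa [← Complex.coe_smul, ← Complex.coe_smul] at this

theorem map_neg (hR : IsCliffordStructure R) (z : EuclideanSpace ℂ (Fin d)) :
    R (-z) = -R z := by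
  simpa using hR.map_ofReal_smul (-1) z

theorem anticommutator (hR : IsCliffordStructure R) (z w : EuclideanSpace ℂ (Fin d)) :
    R z * R w + R w * R z = ((2 * (inner ℂ z w).re : ℝ) : ℂ) • (1 : K →L[ℂ] K) := by
  have h := hR.2.2.2 (z + w)
  have hn : (‖z + w‖ : ℂ) ^ 2 = ‖z‖ ^ 2 + ((2 * (inner ℂ z w).re : ℝ) : ℂ) + ‖w‖ ^ 2 := by
    have := norm_add_sq (𝕜 := ℂ) z w
    exact_mod_cast this
  rw [hR.1, mul_add, add_mul, add_mul, hR.2.2.2 z, hR.2.2.2 w, hn, add_smul, add_smul] at h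
  have h' := sub_eq_zero.mpr h
  rw [← sub_eq_zero, ← h']
  abel

theorem mem_closure_adjoin (hR : IsCliffordStructure R) {x : K →L[ℂ] K}
    (hx : x ∈ cliffordAlgebraOf R) :
    x ∈ closure (Algebra.adjoin ℂ (Set.range R) : Set (K →L[ℂ] K)) := by
  have hstar : star (Set.range R) = Set.range R := by
    ext y
    constructor
    · rintro ⟨z, hz⟩
      exact ⟨z, by rw [← star_star y, ← hz, (hR.2.2.1 z).star_eq]⟩
    · rintro ⟨z, rfl⟩
      exact ⟨z, (hR.2.2.1 z).star_eq.symm⟩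
  have h : x ∈ closure ((StarAlgebra.adjoin ℂ (Set.range R)).toSubalgebra : Set (K →L[ℂ] K)) := hx
  rwa [StarAlgebra.adjoin_toSubalgebra, hstar, Set.union_self] at h

theorem commute_of_mem (hR : IsCliffordStructure R) {T : K →L[ℂ] K}
    (hT : ∀ z, R z * T = T * R z) {a : K →L[ℂ] K} (ha : a ∈ cliffordAlgebraOf R) :
    a * T = T * a := by
  have hle : Algebra.adjoin ℂ (Set.range R) ≤ Subalgebra.centralizer ℂ {T} := by
    rw [Algebra.adjoin_le_iff]
    rintro _ ⟨z, rfl⟩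
    rw [SetLike.mem_coe, Subalgebra.mem_centralizer_iff]
    rintro _ rfl
    exact (hT z).symm
  have hclosed : IsClosed {x : K →L[ℂ] K | x * T = T * x} :=
    isClosed_eq (by fun_prop) (by fun_prop)
  refine closure_minimal (fun y hy => ?_) hclosed (hR.mem_closure_adjoin ha)
  exact ((Subalgebra.mem_centralizer_iff ℂ).mp (hle hy) T rfl).symm

/-- An element of the algebra generated by a Clifford structure that commutes with the
structure is a scalar. -/
theorem exists_eq_smul_one (hR : IsCliffordStructure R) {x : K →L[ℂ] K}
    (hx : x ∈ cliffordAlgebraOf R) (hcomm : ∀ z, R z * x = x * R z) :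
    ∃ c : ℂ, x = c • (1 : K →L[ℂ] K) := by
  let b : Fin d × Bool → EuclideanSpace ℂ (Fin d) := fun p =>
    EuclideanSpace.single p.1 (if p.2 then Complex.I else 1)
  have hnorm (p) : ‖b p‖ = 1 := by
    rcases p with ⟨j, _ | _⟩ <;> simp [b]
  have horth (p q) (hpq : p ≠ q) : (inner ℂ (b p) (b q)).re = 0 := by
    rcases p with ⟨j, s⟩
    rcases q with ⟨k, t⟩
    by_cases hjk : j = k
    · subst hjk
      cases s <;> cases t <;> simp_all [b, EuclideanSpace.inner_single_left]
    · simp [b, EuclideanSpace.inner_single_left, hjk]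
  have hspan (z) : R z ∈ Algebra.adjoin ℂ (Set.range fun p => R (b p)) := by
    let f : EuclideanSpace ℂ (Fin d) →+ (K →L[ℂ] K) := AddMonoidHom.mk' R hR.1
    have hz : z = ∑ j, (((z j).re : ℂ) • b (j, false) + ((z j).im : ℂ) • b (j, true)) := by
      ext k
      simp [b, Finset.sum_add_distrib, Pi.single_apply, Complex.re_add_im]
    have hRz : R z = ∑ j, (((z j).re : ℂ) • R (b (j, false)) + ((z j).im : ℂ) • R (b (j, true))) := by
      conv_lhs => rw [hz]
      refine (map_sum f _ _).trans (Finset.sum_congr rfl fun j _ => ?_)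
      rw [map_add]
      exact congrArg₂ _ (hR.map_ofReal_smul _ _) (hR.map_ofReal_smul _ _)
    rw [hRz]
    exact sum_mem fun j _ => add_mem
      (Subalgebra.smul_mem _ (Algebra.subset_adjoin (Set.mem_range_self _)) _)
      (Subalgebra.smul_mem _ (Algebra.subset_adjoin (Set.mem_range_self _)) _)
  have hle : Algebra.adjoin ℂ (Set.range R) ≤ Algebra.adjoin ℂ (Set.range fun p => R (b p)) := by
    rw [Algebra.adjoin_le_iff]
    rintro _ ⟨z, rfl⟩
    exact hspan z
  refine CliffordWords.mem_span_one_of_commute (e := fun p => R (b p)) (by simp)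
    (fun p => by simp [hR.2.2.2, hnorm]) (fun p q hpq => ?_)
    (closure_mono hle (hR.mem_closure_adjoin hx)) (fun p => hcomm _)
  have := hR.anticommutator (b p) (b q)
  rw [horth p q hpq] at this
  simpa [add_eq_zero_iff_eq_neg] using this

end IsCliffordStructure

namespace IsUnitaryRep

theorem mul_inv (hΓ : IsUnitaryRep Γ) (u : Circle) : Γ u * Γ u⁻¹ = 1 := by
  rw [← hΓ.1, mul_inv_cancel, hΓ.2.1]

theorem inv_mul (hΓ : IsUnitaryRep Γ) (u : Circle) : Γ u⁻¹ * Γ u = 1 := by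
  rw [← hΓ.1, inv_mul_cancel, hΓ.2.1]

theorem commute (hΓ : IsUnitaryRep Γ) (u v : Circle) : Γ u * Γ v = Γ v * Γ u := by
  rw [← hΓ.1, mul_comm, hΓ.1]

/-- A conjugation identity may be read as a commutation relation. -/
theorem mul_eq_of_conj (hΓ : IsUnitaryRep Γ) {u : Circle} {S T : K →L[ℂ] K}
    (h : Γ u * S * adjoint (Γ u) = T) : Γ u * S = T * Γ u := by
  rw [← h, hΓ.2.2.1, mul_assoc _ (Γ u⁻¹), hΓ.inv_mul, mul_one]

end IsUnitaryRep

theorem IsGaugeGroup.mul_apply (hΓ : IsGaugeGroup R Γ) (u : Circle)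
    (z : EuclideanSpace ℂ (Fin d)) : Γ u * R z = R ((u : ℂ) • z) * Γ u :=
  hΓ.1.mul_eq_of_conj (hΓ.2.2.1 u z)

/-- Two gauge groups of a Clifford structure agree. -/
theorem IsGaugeGroup.unique {Γ' : Circle → K →L[ℂ] K} (hR : IsCliffordStructure R)
    (hΓ : IsGaugeGroup R Γ) (hΓ' : IsGaugeGroup R Γ') {N : ℕ} {E : ℕ → K →L[ℂ] K}
    (hleft : ∀ (u : Circle) n, E n * Γ u = (u : ℂ) ^ n • E n)
    (hΓE : ∑ n ∈ Finset.range N, E n = 1) : Γ' = Γ := by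
  have hscalar (u) : ∃ c : ℂ, Γ' u = c • Γ u := by
    have hmem : Γ' u * Γ u⁻¹ ∈ cliffordAlgebraOf R := mul_mem (hΓ'.2.1 u) (hΓ.2.1 u⁻¹)
    obtain ⟨c, hc⟩ := hR.exists_eq_smul_one hmem fun z => by
      have h1 := hΓ.mul_apply u⁻¹ z
      have h2 := hΓ'.mul_apply u (((u⁻¹ : Circle) : ℂ) • z)
      rw [smul_smul, ← Circle.coe_mul, mul_inv_cancel, Circle.coe_one, one_smul] at h2
      rw [← mul_assoc, ← h2, mul_assoc, ← h1, mul_assoc]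
    refine ⟨c, ?_⟩
    rw [← mul_one (Γ' u), ← hΓ.1.inv_mul u, ← mul_assoc, hc, smul_mul_assoc, one_mul]
  have hzero {Δ : Circle → K →L[ℂ] K} (hΔ : IsGaugeGroup R Δ) :
      ∃ ξ ∈ specSub Δ 0, ξ ≠ 0 := by
    by_contra hcon
    push Not at hcon
    refine hΔ.2.2.2.2 (Set.eq_singleton_iff_unique_mem.mpr ⟨?_, hcon⟩)
    simp [specSub]
  obtain ⟨ξ, hξ, hξ0⟩ := hzero hΓ'
  obtain ⟨n, hn⟩ : ∃ n, E n ξ ≠ 0 := by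
    by_contra hcon
    push Not at hcon
    apply hξ0
    have := congrArg (fun T : K →L[ℂ] K => T ξ) hΓE
    simpa [sum_apply, hcon] using this.symm
  have hchar (u : Circle) : Γ u = (u : ℂ) ^ n • Γ' u := by
    obtain ⟨c, hc⟩ := hscalar u
    have h1 : ξ = c • Γ u ξ := by
      have := hξ u
      rw [hc] at this
      simpa using this.symm
    have h2 : E n ξ = (c * (u : ℂ) ^ n) • E n ξ := by
      conv_lhs => rw [h1, map_smul, ← mul_apply_eq_comp, hleft]
      rw [smul_apply, smul_smul]
    have h3 : c * (u : ℂ) ^ n = 1 := by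
      have : (c * (u : ℂ) ^ n - 1) • E n ξ = 0 := by rw [sub_smul, ← h2, one_smul, sub_self]
      exact sub_eq_zero.mp ((smul_eq_zero.mp this).resolve_right hn)
    rw [hc, smul_smul, mul_comm, h3, one_smul]
  have hn0 : n = 0 := by
    by_contra hne
    obtain ⟨η, hη, hη0⟩ := hzero hΓ
    have hmem : η ∈ specSub Γ' (-(n : ℤ)) := fun u => by
      have := hη u
      rw [hchar u] at this
      simp only [smul_apply, zpow_zero, Circle.coe_one, one_smul] at this
      conv_rhs => rw [← this, smul_smul]
      simp [Circle.coe_ne_zero]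
    rw [hΓ'.2.2.2.1 _ (by omega)] at hmem
    exact hη0 hmem
  funext u
  simp [hchar u, hn0]

/-- A Dirac operator has only components of degrees `1` and `-1` under the gauge action: its
conjugates satisfy the recursion with characteristic roots `u` and `u⁻¹`. -/
theorem conj_recursion (hR : IsCliffordStructure R) (hΓ : IsGaugeGroup R Γ) {D : K →L[ℂ] K}
    (hodd : Γ negOne * D * adjoint (Γ negOne) = -D)
    (hanti : ∀ z, ∀ a ∈ cliffordAlgebraOf R,
      (R z * D + D * R z) * a = a * (R z * D + D * R z)) (u : Circle) :
    Γ (u * u) * D * Γ (u * u)⁻¹ - ((2 * (u : ℂ).re : ℝ) : ℂ) • (Γ u * D * Γ u⁻¹) + D = 0 := by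
  set c : ℂ := ((2 * (u : ℂ).re : ℝ) : ℂ) with hc
  set S := Γ (u * u) * D * Γ (u * u)⁻¹ - c • (Γ u * D * Γ u⁻¹) + D with hS
  have hconj (w : Circle) (z) : R z * (Γ w * D * Γ w⁻¹) + Γ w * D * Γ w⁻¹ * R z =
      R (((w⁻¹ : Circle) : ℂ) • z) * D + D * R (((w⁻¹ : Circle) : ℂ) • z) := by
    have h1 := hΓ.mul_apply w⁻¹ z
    have h2 := hΓ.mul_apply w (((w⁻¹ : Circle) : ℂ) • z)
    rw [smul_smul, ← Circle.coe_mul, mul_inv_cancel, Circle.coe_one, one_smul] at h2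
    have h3 := hanti (((w⁻¹ : Circle) : ℂ) • z) (Γ w) (hΓ.2.1 w)
    calc R z * (Γ w * D * Γ w⁻¹) + Γ w * D * Γ w⁻¹ * R z
        = (R z * Γ w) * D * Γ w⁻¹ + Γ w * D * (Γ w⁻¹ * R z) := by noncomm_ring
      _ = Γ w * (R (((w⁻¹ : Circle) : ℂ) • z) * D + D * R (((w⁻¹ : Circle) : ℂ) • z)) * Γ w⁻¹ := by
        rw [← h2, h1]; noncomm_ring
      _ = _ := by rw [← h3, mul_assoc, hΓ.1.mul_inv, mul_one]
  have hanticomm (z) : R z * S + S * R z = 0 := by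
    have hz : R ((((u * u)⁻¹ : Circle) : ℂ) • z) + R z = c • R (((u⁻¹ : Circle) : ℂ) • z) := by
      rw [hc, ← hR.map_ofReal_smul, ← hR.1, smul_smul]
      nth_rewrite 2 [← one_smul ℂ z]
      rw [← add_smul]
      congr 2
      have hu := Circle.coe_ne_zero u
      have : ((2 * (u : ℂ).re : ℝ) : ℂ) = u + (u : ℂ)⁻¹ := by
        rw [← Circle.coe_inv, Circle.coe_inv_eq_conj, Complex.add_conj]
      rw [this, Circle.coe_inv, Circle.coe_inv, Circle.coe_mul]
      field_simp
      ring
    calc R z * S + S * R z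
        = (R z * (Γ (u * u) * D * Γ (u * u)⁻¹) + Γ (u * u) * D * Γ (u * u)⁻¹ * R z)
          - c • (R z * (Γ u * D * Γ u⁻¹) + Γ u * D * Γ u⁻¹ * R z) + (R z * D + D * R z) := by
          rw [hS, mul_add, mul_sub, add_mul, sub_mul, mul_smul_comm, smul_mul_assoc, smul_add]
          abel
      _ = (R ((((u * u)⁻¹ : Circle) : ℂ) • z) + R z) * D +
          D * (R ((((u * u)⁻¹ : Circle) : ℂ) • z) + R z) -
          c • (R (((u⁻¹ : Circle) : ℂ) • z) * D + D * R (((u⁻¹ : Circle) : ℂ) • z)) := by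
          rw [hconj, hconj, mul_add, add_mul]
          abel
      _ = 0 := by rw [hz, mul_smul_comm, smul_mul_assoc, smul_add, sub_self]
  have hneg (z) : Γ negOne * R z = -(R z * Γ negOne) := by
    rw [hΓ.mul_apply, show ((negOne : Circle) : ℂ) = -1 from rfl, neg_one_smul, hR.map_neg, neg_mul]
  have hcomm (v : Circle) : Γ v * S = S * Γ v := by
    have h := hR.commute_of_mem (T := Γ negOne * S) (fun z => by
      rw [← mul_assoc, ← neg_eq_iff_eq_neg.mpr (hneg z), neg_mul, mul_assoc, mul_assoc,
        eq_neg_of_add_eq_zero_left (hanticomm z), mul_neg, neg_neg]) (hΓ.2.1 v)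
    rw [← mul_assoc, hΓ.1.commute, mul_assoc, mul_assoc] at h
    have := congrArg (fun T => Γ negOne⁻¹ * T) h
    simpa only [← mul_assoc, hΓ.1.inv_mul, one_mul] using this
  have hDneg : Γ negOne * D = -(D * Γ negOne) := by
    rw [hΓ.1.mul_eq_of_conj hodd, neg_mul]
  have hodd' (w : Circle) : Γ negOne * (Γ w * D * Γ w⁻¹) = -(Γ w * D * Γ w⁻¹ * Γ negOne) := by
    rw [mul_assoc _ (Γ w⁻¹), hΓ.1.commute w⁻¹, ← mul_assoc, ← mul_assoc, hΓ.1.commute,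
      mul_assoc (Γ w), hDneg]
    noncomm_ring
  have hSneg : Γ negOne * S = -(S * Γ negOne) := by
    rw [hS, mul_add, mul_sub, mul_smul_comm, hodd', hodd', hDneg, add_mul, sub_mul,
      smul_mul_assoc, smul_neg]
    abel
  rw [hcomm] at hSneg
  have h0 : S * Γ negOne = 0 := by
    rw [← CliffordWords.half_smul_add_self (S * Γ negOne)]
    nth_rewrite 1 [hSneg]
    rw [neg_add_cancel, smul_zero]
  rw [← mul_one S, ← hΓ.1.mul_inv negOne, ← mul_assoc, h0, zero_mul]

end GaugeGroup

/-- **Remark 3.8.** For a Dirac operator `(D,R)` with gauge group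
`Γ(λ) = Σ_{n=0}^d λⁿ Eₙ` (`Eₙ` the spectral projections onto `Hₙ`), the operator
`B = Σ E_{n+1} D Eₙ` satisfies `B² = 0` and `D = B + B*`; moreover `B` maps `Hₙ` into
`H_{n+1}` and `B*` maps `Hₙ` into `H_{n-1}`. -/
theorem arveson_stmt12 {d : ℕ} {K : Type*} [NormedAddCommGroup K] [InnerProductSpace ℂ K]
    [CompleteSpace K] (D : K →L[ℂ] K) (R : EuclideanSpace ℂ (Fin d) → K →L[ℂ] K)
    (h : IsDiracOperator D R) (Γ : Circle → K →L[ℂ] K) (hΓ : IsGaugeGroup R Γ)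
    (E : ℕ → K →L[ℂ] K)
    (hEsa : ∀ n, IsSelfAdjoint (E n)) (hEidem : ∀ n, E n * E n = E n)
    (hEmem : ∀ n : ℕ, ∀ ξ, E n ξ ∈ specSub Γ (n : ℤ))
    (hEfix : ∀ n : ℕ, ∀ ξ ∈ specSub Γ (n : ℤ), E n ξ = ξ)
    (hΓE : ∀ u : Circle, Γ u = ∑ n ∈ Finset.range (d + 1), ((u : ℂ) ^ n) • E n)
    (B : K →L[ℂ] K) (hB : B = ∑ n ∈ Finset.range (d + 1), E (n + 1) * D * E n) :
    B * B = 0 ∧ D = B + ContinuousLinearMap.adjoint B ∧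
    ∀ (n : ℤ) (ξ : K), ξ ∈ specSub Γ n →
      B ξ ∈ specSub Γ (n + 1) ∧ ContinuousLinearMap.adjoint B ξ ∈ specSub Γ (n - 1) := by
  obtain ⟨hDsa, hR, Γ', hΓ', hodd, heven, hanti⟩ := h
  have hright (u : Circle) (n : ℕ) : Γ u * E n = (u : ℂ) ^ n • E n := by
    ext ξ
    simpa using hEmem n ξ u
  have hleft (u : Circle) (n : ℕ) : E n * Γ u = (u : ℂ) ^ n • E n := by
    have := congrArg adjoint (hright u⁻¹ n)
    rw [← star_eq_adjoint, ← star_eq_adjoint, star_mul, star_smul, (hEsa n).star_eq,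
      star_eq_adjoint, hΓ.1.2.2.1, inv_inv] at this
    rw [this]
    congr 1
    rw [star_pow, ← starRingEnd_apply, Circle.coe_inv_eq_conj, Complex.conj_conj]
  have hsum : ∑ n ∈ Finset.range (d + 1), E n = 1 := by
    rw [← hΓ.1.2.1, hΓE 1]
    simp
  rw [hΓ.unique hR hΓ' hleft hsum] at hodd heven
  obtain ⟨v, hv⟩ := exists_circle_zpow_ne_one
  have hv0 := Circle.coe_ne_zero v
  have horth (m n : ℕ) (hmn : m ≠ n) : E m * E n = 0 := by
    have h1 : (v : ℂ) ^ m • (E m * E n) = (v : ℂ) ^ n • (E m * E n) := by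
      rw [← smul_mul_assoc, ← hleft, mul_assoc, hright, mul_smul_comm]
    rw [← sub_eq_zero, ← sub_smul] at h1
    refine (smul_eq_zero.mp h1).resolve_left fun h0 => hv ((m : ℤ) - n) (by omega) ?_
    rw [zpow_sub₀ hv0, zpow_natCast, zpow_natCast, sub_eq_zero.mp h0, div_self (pow_ne_zero _ hv0)]
  have hvanish (n : ℕ) (hn : d < n) : E n = 0 := by
    rw [← one_mul (E n), ← hsum, Finset.sum_mul]
    exact Finset.sum_eq_zero fun m hm => horth m n (by have := Finset.mem_range.mp hm; omega)
  have hBE (n : ℕ) : B * E n = E (n + 1) * D * E n := by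
    by_cases hn : d < n
    · simp [hvanish n hn]
    · rw [hB, Finset.sum_mul, Finset.sum_eq_single n]
      · rw [mul_assoc, hEidem]
      · intro m _ hm
        rw [mul_assoc, horth m n hm, mul_zero]
      · intro h
        simp at h
        omega
  have hEB (n : ℕ) : E n * adjoint B = E n * D * E (n + 1) := by
    have := congrArg star (hBE n)
    simpa [star_mul, (hEsa _).star_eq, hDsa.star_eq, star_eq_adjoint, mul_assoc] using this
  have hdeg (m n : ℕ) (h1 : m ≠ n + 1) (h2 : n ≠ m + 1) : E m * D * E n = 0 := by
    have hconj (w : Circle) : E m * (Γ w * D * Γ w⁻¹) * E n =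
        (w : ℂ) ^ ((m : ℤ) - n) • (E m * D * E n) := by
      rw [show E m * (Γ w * D * Γ w⁻¹) * E n = (E m * Γ w) * D * (Γ w⁻¹ * E n) by noncomm_ring,
        hleft, hright, smul_mul_assoc, smul_mul_assoc, mul_smul_comm, smul_smul, Circle.coe_inv,
        zpow_sub₀ (Circle.coe_ne_zero w), zpow_natCast, zpow_natCast, inv_pow, div_eq_mul_inv]
    have hrec := congrArg (fun T => E m * T * E n) (conj_recursion hR hΓ hodd hanti v)
    simp only [mul_add, mul_sub, add_mul, sub_mul, mul_smul_comm, smul_mul_assoc, hconj, mul_zero,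
      zero_mul] at hrec
    rw [smul_smul, ← sub_smul] at hrec
    nth_rewrite 2 [← one_smul ℂ (E m * D * E n)] at hrec
    rw [← add_smul] at hrec
    refine (smul_eq_zero.mp hrec).resolve_left fun h0 => ?_
    have hre : ((2 * (v : ℂ).re : ℝ) : ℂ) = v + (v : ℂ)⁻¹ := by
      rw [← Circle.coe_inv, Circle.coe_inv_eq_conj, Complex.add_conj]
    rw [hre, Circle.coe_mul, mul_zpow] at h0
    have hfac : ((v : ℂ) ^ ((m : ℤ) - n) - v) * ((v : ℂ) ^ ((m : ℤ) - n) - (v : ℂ)⁻¹) = 0 := by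
      rw [← h0]
      linear_combination mul_inv_cancel₀ hv0
    rcases mul_eq_zero.mp hfac with h | h
    · refine hv ((m : ℤ) - n - 1) (by omega) ?_
      rw [zpow_sub_one₀ hv0, sub_eq_zero.mp h, mul_inv_cancel₀ hv0]
    · refine hv ((m : ℤ) - n + 1) (by omega) ?_
      rw [zpow_add_one₀ hv0, sub_eq_zero.mp h, inv_mul_cancel₀ hv0]
  have hDB : D = B + adjoint B := by
    have hblock (m n : ℕ) : E m * (D - (B + adjoint B)) * E n = 0 := by
      have h1 : E m * (D - (B + adjoint B)) * E n =
          E m * D * E n - (E m * E (n + 1)) * D * E n - E m * D * (E (m + 1) * E n) := by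
        rw [mul_sub, mul_add, sub_mul, add_mul, hEB, mul_assoc (E m) B, hBE]
        noncomm_ring
      rw [h1]
      by_cases hmn : m = n + 1
      · subst hmn
        rw [hEidem, horth (n + 1 + 1) n (by omega), mul_zero, sub_self, sub_zero]
      · by_cases hnm : n = m + 1
        · subst hnm
          rw [hEidem, horth m (m + 1 + 1) (by omega), zero_mul, zero_mul, sub_zero, sub_self]
        · rw [hdeg m n hmn hnm, horth m (n + 1) hmn, horth (m + 1) n (Ne.symm hnm)]
          simp
    rw [← sub_eq_zero]
    calc D - (B + adjoint B) = 1 * (D - (B + adjoint B)) * 1 := by simp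
      _ = 0 := by
        rw [← hsum, Finset.sum_mul, Finset.sum_mul]
        refine Finset.sum_eq_zero fun m _ => ?_
        rw [Finset.mul_sum]
        exact Finset.sum_eq_zero fun n _ => hblock m n
  have hΓB (u : Circle) : Γ u * B = (u : ℂ) • (B * Γ u) := by
    rw [hB, Finset.mul_sum, Finset.sum_mul, Finset.smul_sum]
    refine Finset.sum_congr rfl fun n _ => ?_
    rw [← mul_assoc, ← mul_assoc, hright, mul_assoc _ (E n), hleft, mul_smul_comm, smul_smul,
      smul_mul_assoc, smul_mul_assoc, pow_succ']
  have hBΓ (u : Circle) : adjoint B * Γ u = (u : ℂ) • (Γ u * adjoint B) := by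
    have := congrArg star (hΓB u⁻¹)
    rw [star_mul, star_smul, star_mul, star_eq_adjoint, star_eq_adjoint, hΓ.1.2.2.1, inv_inv,
      ← starRingEnd_apply, Circle.coe_inv_eq_conj, Complex.conj_conj] at this
    exact this
  have hΓB' (u : Circle) : Γ u * adjoint B = (u : ℂ)⁻¹ • (adjoint B * Γ u) := by
    rw [hBΓ, smul_smul, inv_mul_cancel₀ (Circle.coe_ne_zero u), one_smul]
  refine ⟨?_, hDB, fun n ξ hξ => ⟨fun u => ?_, fun u => ?_⟩⟩
  · have hsq (u : Circle) : (u : ℂ) ^ 2 • (B * B) = adjoint B * adjoint B ∨ (u : ℂ) ^ 2 = 1 := by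
      set C := adjoint B with hC
      have hu := Circle.coe_ne_zero u
      have h1 : Γ u * (D * D) = D * D * Γ u := hΓ.1.mul_eq_of_conj (heven u)
      have hBB : Γ u * (B * B) = (u : ℂ) ^ 2 • (B * B * Γ u) := by
        rw [← mul_assoc, hΓB, smul_mul_assoc, mul_assoc B, hΓB, mul_smul_comm, smul_smul, sq,
          mul_assoc]
      have hCC : Γ u * (C * C) = ((u : ℂ) ^ 2)⁻¹ • (C * C * Γ u) := by
        rw [← mul_assoc, hΓB', smul_mul_assoc, mul_assoc C, hΓB', mul_smul_comm, smul_smul, sq,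
          mul_inv, mul_assoc]
      have hBC : Γ u * (B * C) = B * C * Γ u := by
        rw [← mul_assoc, hΓB, smul_mul_assoc, mul_assoc B, hΓB', mul_smul_comm, smul_smul,
          mul_inv_cancel₀ hu, one_smul, mul_assoc]
      have hCB : Γ u * (C * B) = C * B * Γ u := by
        rw [← mul_assoc, hΓB', smul_mul_assoc, mul_assoc C, hΓB, mul_smul_comm, smul_smul,
          inv_mul_cancel₀ hu, one_smul, mul_assoc]
      have hexp : D * D = B * B + B * C + (C * B + C * C) := by
        rw [hDB]; noncomm_ring
      rw [hexp, mul_add, mul_add, mul_add, hBB, hBC, hCB, hCC, add_mul, add_mul, add_mul] at h1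
      have h2 : ((u : ℂ) ^ 2 • (B * B) - B * B + (((u : ℂ) ^ 2)⁻¹ • (C * C) - C * C)) * Γ u = 0 := by
        rw [← sub_eq_zero] at h1
        rw [← h1, add_mul, sub_mul, sub_mul, smul_mul_assoc, smul_mul_assoc]
        abel
      have h3 : (u : ℂ) ^ 2 • (B * B) - B * B + (((u : ℂ) ^ 2)⁻¹ • (C * C) - C * C) = 0 := by
        have := congrArg (fun T => T * Γ u⁻¹) h2
        simpa only [mul_assoc _ (Γ u), hΓ.1.mul_inv, mul_one, zero_mul] using this
      by_cases h4 : (u : ℂ) ^ 2 = 1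
      · exact Or.inr h4
      left
      have h5 : (1 - ((u : ℂ) ^ 2)⁻¹) • ((u : ℂ) ^ 2 • (B * B) - C * C) = 0 := by
        rw [← h3, sub_smul, one_smul, smul_sub, smul_smul, inv_mul_cancel₀ (pow_ne_zero 2 hu),
          one_smul]
        abel
      refine sub_eq_zero.mp ((smul_eq_zero.mp h5).resolve_left fun h6 => h4 ?_)
      exact inv_eq_one.mp (sub_eq_zero.mp h6).symm
    have hv2 : (v : ℂ) ^ 2 ≠ 1 := by exact_mod_cast hv 2 (by decide)
    have hv4 : ((v * v : Circle) : ℂ) ^ 2 ≠ 1 := by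
      rw [Circle.coe_mul, ← sq, ← pow_mul]
      exact_mod_cast hv 4 (by decide)
    have h1 := ((hsq v).resolve_right hv2).trans ((hsq (v * v)).resolve_right hv4).symm
    rw [← sub_eq_zero, ← sub_smul] at h1
    refine (smul_eq_zero.mp h1).resolve_left fun h0 => hv2 ?_
    rw [Circle.coe_mul] at h0
    have h2 : (v : ℂ) ^ 2 * (1 - (v : ℂ) ^ 2) = 0 := by rw [← h0]; ring
    exact (sub_eq_zero.mp ((mul_eq_zero.mp h2).resolve_left (pow_ne_zero 2 hv0))).symm
  · have h1 := congrArg (fun T : K →L[ℂ] K => T ξ) (hΓB u)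
    simp only [mul_apply_eq_comp, smul_apply, hξ u, map_smul, smul_smul] at h1
    rw [h1, Circle.coe_zpow, Circle.coe_zpow, zpow_add_one₀ (Circle.coe_ne_zero u), mul_comm]
  · have h1 := congrArg (fun T : K →L[ℂ] K => T ξ) (hΓB' u)
    simp only [mul_apply_eq_comp, smul_apply, hξ u, map_smul, smul_smul] at h1
    rw [h1, Circle.coe_zpow, Circle.coe_zpow, zpow_sub_one₀ (Circle.coe_ne_zero u), mul_comm]

end
end

section
/- Every finitely generated module M over the polynomial ring ℂ[z₁,…,z_d] is of finite type, and for any finite free resolution 0 → F_n → … → F₁ → M → 0 (which exists by Hilbert's syzygy theorem, each F_k free of finite rank) one has e(M) = (−1)^d Σ_{k=1}^n (−1)^{k+1} rank(F_k); that is, e(M) = (−1)^d χ(M) where χ(M) is the Euler characteristic of M. -/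
noncomputable section

section Koszul

variable {V : Type*} [AddCommGroup V] [Module ℂ V]

/-- The Koszul coboundary operator `B = T₁⊗c₁ + ⋯ + T_d⊗c_d` associated with a family of
commuting linear maps, modelled on `Λℂ^d`-valued coefficients, i.e. on functions
`Finset (Fin d) → V`. -/
def kozB (d : ℕ) (T : Fin d → V →ₗ[ℂ] V) :
    (Finset (Fin d) → V) →ₗ[ℂ] (Finset (Fin d) → V) where
  toFun f := fun S => ∑ k : Fin d,
    if k ∈ S then ((-1 : ℂ) ^ (S.filter (fun j => j < k)).card) • T k (f (S.erase k)) else 0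
  map_add' f g := by
    funext S
    rw [Pi.add_apply, ← Finset.sum_add_distrib]
    refine Finset.sum_congr rfl fun k _ => ?_
    by_cases h : k ∈ S <;> simp [h, smul_add]
  map_smul' c f := by
    funext S
    simp only [RingHom.id_apply, Pi.smul_apply]
    rw [Finset.smul_sum]
    refine Finset.sum_congr rfl fun k _ => ?_
    by_cases h : k ∈ S
    · rw [if_pos h, if_pos h, map_smul, smul_comm]
    · rw [if_neg h, if_neg h, smul_zero]

/-- The homogeneous subspace of `k`-forms: functions supported on sets of cardinality `k`. -/
def degSub (d : ℕ) (V : Type*) [AddCommGroup V] [Module ℂ V] (k : ℕ) :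
    Submodule ℂ (Finset (Fin d) → V) where
  carrier := {f | ∀ S, S.card ≠ k → f S = 0}
  add_mem' := by intro f g hf hg S hS; simp [hf S hS, hg S hS]
  zero_mem' := by intro S _; rfl
  smul_mem' := by intro c f hf S hS; simp [hf S hS]

/-- Forms with values in a subspace `W ⊆ V`. -/
def inSub (d : ℕ) (W : Submodule ℂ V) : Submodule ℂ (Finset (Fin d) → V) :=
  Submodule.pi Set.univ fun _ => W

/-- Koszul cocycles of degree `k` (of the subcomplex of `W`-valued forms). -/
def kozZ (d : ℕ) (T : Fin d → V →ₗ[ℂ] V) (W : Submodule ℂ V) (k : ℕ) :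
    Submodule ℂ (Finset (Fin d) → V) :=
  LinearMap.ker (kozB d T) ⊓ inSub d W ⊓ degSub d V k

/-- Koszul coboundaries of degree `k` (of the subcomplex of `W`-valued forms). -/
def kozCob (d : ℕ) (T : Fin d → V →ₗ[ℂ] V) (W : Submodule ℂ V) (k : ℕ) :
    Submodule ℂ (Finset (Fin d) → V) :=
  Submodule.map (kozB d T) (inSub d W ⊓ degSub d V (k - 1))

/-- The `k`-th Koszul cohomology space `H^k = Z^k / B^k`. -/
abbrev kozH (d : ℕ) (T : Fin d → V →ₗ[ℂ] V) (W : Submodule ℂ V) (k : ℕ) :=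
  ↥(kozZ d T W k) ⧸ Submodule.comap (kozZ d T W k).subtype (kozCob d T W k)

/-- Finite type: all Koszul cohomology spaces in degrees `0,…,d` are finite dimensional. -/
def KozFiniteType (d : ℕ) (T : Fin d → V →ₗ[ℂ] V) (W : Submodule ℂ V) : Prop :=
  ∀ k ≤ d, FiniteDimensional ℂ (kozH d T W k)

/-- The Euler number `e = Σ (-1)^k dim H^k`. -/
def eulerNum (d : ℕ) (T : Fin d → V →ₗ[ℂ] V) (W : Submodule ℂ V) : ℤ :=
  ∑ k ∈ Finset.range (d + 1), (-1 : ℤ) ^ k * (Module.finrank ℂ (kozH d T W k) : ℤ)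

end Koszul

section PolyModule

variable {d : ℕ} {M : Type*} [AddCommGroup M] [Module ℂ M]
  [Module (MvPolynomial (Fin d) ℂ) M] [IsScalarTower ℂ (MvPolynomial (Fin d) ℂ) M]

/-- Multiplication by the variable `z_j` on a module over `ℂ[z₁,…,z_d]`, as a
`ℂ`-linear map. -/
def polyT (d : ℕ) (M : Type*) [AddCommGroup M] [Module ℂ M]
    [Module (MvPolynomial (Fin d) ℂ) M] [IsScalarTower ℂ (MvPolynomial (Fin d) ℂ) M]
    (j : Fin d) : M →ₗ[ℂ] M where
  toFun m := (MvPolynomial.X j : MvPolynomial (Fin d) ℂ) • m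
  map_add' m m' := smul_add (MvPolynomial.X j : MvPolynomial (Fin d) ℂ) m m'
  map_smul' c m := by
    show (MvPolynomial.X j : MvPolynomial (Fin d) ℂ) • (c • m) =
      c • ((MvPolynomial.X j : MvPolynomial (Fin d) ℂ) • m)
    exact smul_comm _ c m

/-- A `ℂ[z₁,…,z_d]`-module is of finite type if its Koszul cohomology spaces are all
finite dimensional. -/
def ModFiniteType (d : ℕ) (M : Type*) [AddCommGroup M] [Module ℂ M]
    [Module (MvPolynomial (Fin d) ℂ) M] [IsScalarTower ℂ (MvPolynomial (Fin d) ℂ) M] : Prop :=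
  KozFiniteType d (polyT d M) (⊤ : Submodule ℂ M)

/-- The Euler number `e(M)` of a `ℂ[z₁,…,z_d]`-module. -/
def modEuler (d : ℕ) (M : Type*) [AddCommGroup M] [Module ℂ M]
    [Module (MvPolynomial (Fin d) ℂ) M] [IsScalarTower ℂ (MvPolynomial (Fin d) ℂ) M] : ℤ :=
  eulerNum d (polyT d M) (⊤ : Submodule ℂ M)

end PolyModule

section Resolution

/-- The polynomial algebra `ℂ[z₁,…,z_d]`. -/
abbrev PolyA (d : ℕ) := MvPolynomial (Fin d) ℂ

/-- A finite free resolution `0 → F_n → ⋯ → F₁ → M → 0` of a module `M` over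
`ℂ[z₁,…,z_d]`, where `F_k` is the free module of rank `r k` (with `r k = 0` for `k > n`),
`δ k : F_{k+2} → F_{k+1}` and `ε : F₁ → M`. -/
def IsFreeResolution (d : ℕ) (M : Type*) [AddCommGroup M] [Module (PolyA d) M]
    (n : ℕ) (r : ℕ → ℕ)
    (δ : ∀ k : ℕ, (Fin (r (k + 2)) → PolyA d) →ₗ[PolyA d] (Fin (r (k + 1)) → PolyA d))
    (ε : (Fin (r 1) → PolyA d) →ₗ[PolyA d] M) : Prop :=
  Function.Surjective ε ∧
  LinearMap.range (δ 0) = LinearMap.ker ε ∧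
  (∀ k, LinearMap.range (δ (k + 1)) = LinearMap.ker (δ k)) ∧
  (∀ k, n < k → r k = 0)

/-- The Euler characteristic `χ = Σ_{k=1}^n (-1)^{k+1} rank F_k` of a finite free
resolution. -/
def resChi (n : ℕ) (r : ℕ → ℕ) : ℤ :=
  ∑ k ∈ Finset.Icc 1 n, (-1 : ℤ) ^ (k + 1) * (r k : ℤ)

end Resolution

section FiniteFreeResolution

open Polynomial

universe u

/-- `M` has a resolution by free modules of finite rank with at most `n` nonzero terms. -/
def HasFreeRes (R : Type u) [CommRing R] :
    ℕ → ∀ (M : Type u) [AddCommGroup M] [Module R M], Prop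
  | 0, M, _, _ => Subsingleton M
  | n + 1, M, _, _ => ∃ (r : ℕ) (φ : (Fin r → R) →ₗ[R] M),
      Function.Surjective φ ∧ HasFreeRes R n (LinearMap.ker φ)

namespace HasFreeRes

variable {R S : Type u} [CommRing R] [CommRing S]

theorem of_semilinear (e : R ≃+* S) (n : ℕ) :
    ∀ {M N : Type u} [AddCommGroup M] [Module R M] [AddCommGroup N] [Module S N]
      (f : M ≃+ N) (_ : ∀ (a : R) (m : M), f (a • m) = e a • f m),
      HasFreeRes R n M → HasFreeRes S n N := by
  induction n with
  | zero =>
    intro M N _ _ _ _ f _ h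
    have : Subsingleton M := h
    exact f.symm.toEquiv.subsingleton
  | succ n ih =>
    rintro M N _ _ _ _ f hf ⟨r, φ, hφ, hK⟩
    have hf' (s : S) (m : M) : f (e.symm s • m) = s • f m := by simp [hf]
    let g : (Fin r → R) ≃+ (Fin r → S) := AddEquiv.piCongrRight fun _ => e.toAddEquiv
    let ψ : (Fin r → S) →ₗ[S] N :=
      { toFun := fun v => f (φ (g.symm v))
        map_add' := by simp
        map_smul' := by
          intro s v
          rw [RingHom.id_apply, ← hf', ← map_smul]
          congr 2
          ext i
          simp [g] }
    have hmem (v : Fin r → R) : v ∈ LinearMap.ker φ ↔ g v ∈ LinearMap.ker ψ := by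
      simp [ψ, LinearMap.mem_ker]
    refine ⟨r, ψ, ?_, ?_⟩
    · intro y
      obtain ⟨v, hv⟩ := hφ (f.symm y)
      exact ⟨g v, by simp [ψ, hv]⟩
    · refine ih (M := LinearMap.ker φ) (N := LinearMap.ker ψ)
        { toFun := fun v => ⟨g v, (hmem v).1 v.2⟩
          invFun := fun w => ⟨g.symm w, (hmem _).2 (by simp)⟩
          left_inv := fun v => by simp
          right_inv := fun w => by simp
          map_add' := fun v w => by ext; simp } ?_ hK
      intro a v
      ext i
      simp [g]

theorem of_linearEquiv {n : ℕ} {M N : Type u} [AddCommGroup M] [Module R M] [AddCommGroup N]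
    [Module R N] (f : M ≃ₗ[R] N) (h : HasFreeRes R n M) : HasFreeRes R n N :=
  of_semilinear (RingEquiv.refl R) n f.toAddEquiv (by simp) h

theorem of_exact {n r : ℕ} {K F M : Type u} [AddCommGroup K] [Module R K] [AddCommGroup F]
    [Module R F] [AddCommGroup M] [Module R M] (θ : F ≃ₗ[R] (Fin r → R)) (ι : K →ₗ[R] F)
    (φ : F →ₗ[R] M) (hι : Function.Injective ι) (hex : Function.Exact ι φ)
    (hφ : Function.Surjective φ) (h : HasFreeRes R n K) : HasFreeRes R (n + 1) M := by
  refine ⟨r, φ ∘ₗ θ.symm.toLinearMap, hφ.comp θ.symm.surjective, of_linearEquiv ?_ h⟩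
  refine LinearEquiv.ofBijective ((θ.toLinearMap ∘ₗ ι).codRestrict _ fun k => ?_) ⟨?_, ?_⟩
  · simpa using hex.apply_apply_eq_zero k
  · intro a b hab
    simpa [Subtype.ext_iff, hι.eq_iff] using hab
  · rintro ⟨v, hv⟩
    obtain ⟨k, hk⟩ := (hex (θ.symm v)).1 (by simpa using hv)
    exact ⟨k, by ext1; simp [hk]⟩

theorem succ {n : ℕ} : ∀ {M : Type u} [AddCommGroup M] [Module R M],
    HasFreeRes R n M → HasFreeRes R (n + 1) M := by
  induction n with
  | zero =>
    intro M _ _ h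
    have : Subsingleton M := h
    exact ⟨0, 0, fun y => ⟨0, Subsingleton.elim _ _⟩,
      inferInstanceAs (Subsingleton (LinearMap.ker (0 : (Fin 0 → R) →ₗ[R] M)))⟩
  | succ n ih =>
    rintro M _ _ ⟨r, φ, hφ, hK⟩
    exact ⟨r, φ, hφ, ih hK⟩

theorem mono {n m : ℕ} (hnm : n ≤ m) {M : Type u} [AddCommGroup M] [Module R M]
    (h : HasFreeRes R n M) : HasFreeRes R m M := by
  induction hnm with
  | refl => exact h
  | step _ ih => exact ih.succ

/-- The horseshoe lemma: modules with a finite free resolution are closed under extensions. -/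
theorem extension {n : ℕ} : ∀ {M' M M'' : Type u} [AddCommGroup M'] [Module R M']
    [AddCommGroup M] [Module R M] [AddCommGroup M''] [Module R M'']
    (f : M' →ₗ[R] M) (g : M →ₗ[R] M''), Function.Injective f → Function.Exact f g →
    Function.Surjective g → HasFreeRes R n M' → HasFreeRes R n M'' → HasFreeRes R n M := by
  induction n with
  | zero =>
    intro M' M M'' _ _ _ _ _ _ f g _ hex _ h' h''
    have : Subsingleton M' := h'
    have : Subsingleton M'' := h''
    refine ⟨fun a b => ?_⟩
    have key (x : M) : x = 0 := by
      obtain ⟨y, rfl⟩ := (hex x).1 (Subsingleton.elim _ _)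
      rw [Subsingleton.elim y 0, map_zero]
    rw [key a, key b]
  | succ n ih =>
    rintro M' M M'' _ _ _ _ _ _ f g hf hex hg ⟨r', φ', hφ', hK'⟩ ⟨r'', φ'', hφ'', hK''⟩
    obtain ⟨σ, hσ⟩ := Module.projective_lifting_property g φ'' hg
    have hσ' (v) : g (σ v) = φ'' v := by rw [← hσ]; rfl
    let Φ : (Fin r' → R) × (Fin r'' → R) →ₗ[R] M := (f ∘ₗ φ').coprod σ
    have hgΦ (v) : g (Φ v) = φ'' v.2 := by
      simp [Φ, hσ', hex.apply_apply_eq_zero]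
    have hΦ : Function.Surjective Φ := by
      intro m
      obtain ⟨b, hb⟩ := hφ'' (g m)
      obtain ⟨a, ha⟩ := (hex (m - σ b)).1 (by simp [hσ', hb])
      obtain ⟨c, rfl⟩ := hφ' a
      exact ⟨(c, b), by simp [Φ, ha]⟩
    let θ : ((Fin r' → R) × (Fin r'' → R)) ≃ₗ[R] (Fin (r' + r'') → R) :=
      (LinearEquiv.sumArrowLequivProdArrow _ _ R R).symm.trans
        (LinearEquiv.funCongrLeft R R finSumFinEquiv.symm)
    refine of_exact θ (LinearMap.ker Φ).subtype Φ Subtype.val_injective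
      (LinearMap.exact_subtype_ker_map Φ) hΦ ?_
    let j : LinearMap.ker φ' →ₗ[R] LinearMap.ker Φ :=
      (LinearMap.inl R _ _ ∘ₗ (LinearMap.ker φ').subtype).codRestrict _ fun v => by simp [Φ]
    let q : LinearMap.ker Φ →ₗ[R] LinearMap.ker φ'' :=
      (LinearMap.snd R _ _ ∘ₗ (LinearMap.ker Φ).subtype).codRestrict _ fun v => by
        have := hgΦ v
        rw [LinearMap.mem_ker.1 v.2, map_zero] at this
        exact this.symm
    have hj (v) : (j v).1 = (v.1, 0) := rfl
    have hq (v) : (q v).1 = v.1.2 := rfl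
    refine ih j q ?_ ?_ ?_ hK' hK''
    · intro a b hab
      have := congrArg (fun v => v.1.1) hab
      simpa only [hj, Subtype.ext_iff] using this
    · rintro ⟨⟨a, b⟩, hv⟩
      constructor
      · intro h
        have hb : b = 0 := congrArg Subtype.val h
        subst hb
        refine ⟨⟨a, hf ?_⟩, rfl⟩
        rw [map_zero, ← LinearMap.mem_ker.1 hv]
        simp [Φ]
      · rintro ⟨c, hc⟩
        ext1
        rw [← hc]
        rfl
    · rintro ⟨b, hb⟩
      obtain ⟨a, ha⟩ := (hex (σ b)).1 (by rw [hσ', LinearMap.mem_ker.1 hb])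
      obtain ⟨c, rfl⟩ := hφ' a
      exact ⟨⟨(-c, b), by simp [Φ, ha]⟩, rfl⟩

/-- The cokernel of an injection between modules with a finite free resolution has one. -/
theorem cokernel {n : ℕ} {M' M M'' : Type u} [AddCommGroup M'] [Module R M']
    [AddCommGroup M] [Module R M] [AddCommGroup M''] [Module R M'']
    (f : M' →ₗ[R] M) (g : M →ₗ[R] M'') (hf : Function.Injective f) (hex : Function.Exact f g)
    (hg : Function.Surjective g) (h' : HasFreeRes R n M') (h : HasFreeRes R (n + 1) M) :
    HasFreeRes R (n + 1) M'' := by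
  obtain ⟨r, φ, hφ, hK⟩ := h
  refine ⟨r, g ∘ₗ φ, hg.comp hφ, ?_⟩
  let e' : M' ≃ₗ[R] LinearMap.range f := LinearEquiv.ofInjective f hf
  let p : LinearMap.ker (g ∘ₗ φ) →ₗ[R] LinearMap.range f :=
    (φ ∘ₗ Submodule.subtype _).codRestrict _ fun v => (hex _).1 v.2
  refine extension (M' := LinearMap.ker φ) (M'' := LinearMap.range f)
    (Submodule.inclusion (LinearMap.ker_le_ker_comp φ g)) p
    (Submodule.inclusion_injective _) ?_ ?_ hK (of_linearEquiv e' h')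
  · rintro ⟨v, hv⟩
    constructor
    · intro h
      exact ⟨⟨v, congrArg Subtype.val h⟩, rfl⟩
    · rintro ⟨w, hw⟩
      ext1
      rw [← hw]
      exact w.2
  · rintro ⟨_, m, rfl⟩
    obtain ⟨v, hv⟩ := hφ (f m)
    refine ⟨⟨v, ?_⟩, ?_⟩
    · simp [hv, hex.apply_apply_eq_zero]
    · ext1
      exact hv

end HasFreeRes

end FiniteFreeResolution

section PolynomialExtension

open Polynomial

universe u

namespace PolynomialModule

variable {R : Type*} [CommRing R] {M N P : Type*} [AddCommGroup M] [Module R M]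
  [AddCommGroup N] [Module R N] [AddCommGroup P] [Module R P]

/-- The `R[X]`-linear map `M[X] → N[X]` induced by an `R`-linear map `M → N`. -/
def mapX (f : M →ₗ[R] N) : PolynomialModule R M →ₗ[R[X]] PolynomialModule R N where
  toFun := map R f
  map_add' := map_add _
  map_smul' p q := by simp [map_smul]

theorem mapX_single (f : M →ₗ[R] N) (n : ℕ) (m : M) :
    mapX f (single R n m) = single R n (f m) := map_single R f n m

theorem coeff_mapX (f : M →ₗ[R] N) (p : PolynomialModule R M) (n : ℕ) :
    (mapX f p).coeff n = f (p.coeff n) := rfl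

theorem mapX_injective {f : M →ₗ[R] N} (hf : Function.Injective f) :
    Function.Injective (mapX f) := by
  intro p q h
  ext n
  apply hf
  rw [← coeff_mapX, h, coeff_mapX]

theorem mapX_surjective {f : M →ₗ[R] N} (hf : Function.Surjective f) :
    Function.Surjective (mapX f) := by
  intro p
  induction p using induction_linear with
  | zero => exact ⟨0, map_zero _⟩
  | add p q hp hq =>
    obtain ⟨a, rfl⟩ := hp
    obtain ⟨b, rfl⟩ := hq
    exact ⟨a + b, map_add _ _ _⟩
  | single n m =>
    obtain ⟨a, rfl⟩ := hf m
    exact ⟨single R n a, mapX_single _ _ _⟩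

theorem mapX_exact {f : M →ₗ[R] N} {g : N →ₗ[R] P} (h : Function.Exact f g) :
    Function.Exact (mapX f) (mapX g) := by
  classical
  intro p
  constructor
  · intro hp
    have hp' (n : ℕ) : p.coeff n ∈ Set.range f := by
      rw [← h, ← coeff_mapX, hp]
      rfl
    choose q hq using hp'
    refine ⟨ofCoeff R (Finsupp.onFinset p.coeff.support
      (fun n => if p.coeff n = 0 then 0 else q n) fun n hn => ?_), ?_⟩
    · rw [Finsupp.mem_support_iff]
      intro h0
      simp [h0] at hn
    · ext n
      rw [coeff_mapX, coeff_ofCoeff, Finsupp.onFinset_apply]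
      split_ifs with h0
      · rw [h0, map_zero]
      · exact hq n
  · rintro ⟨q, rfl⟩
    ext n
    rw [coeff_mapX, coeff_mapX, h.apply_apply_eq_zero]
    rfl

variable (R) in
/-- The polynomial module of `Rʳ` is `R[X]ʳ`. -/
def piEquiv (r : ℕ) : PolynomialModule R (Fin r → R) ≃ₗ[R[X]] (Fin r → R[X]) :=
  LinearEquiv.ofBijective
    (LinearMap.pi fun i => equivPolynomialSelf.toLinearMap ∘ₗ mapX (LinearMap.proj i)) <| by
    constructor
    · intro p q h
      ext n i
      have := congrFun h i
      simp only [LinearMap.pi_apply, LinearMap.comp_apply, LinearEquiv.coe_coe,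
        EmbeddingLike.apply_eq_iff_eq] at this
      have := congrArg (fun s => s.coeff n) this
      exact this
    · intro v
      refine ⟨∑ i, mapX (LinearMap.single R (fun _ => R) i) (equivPolynomialSelf.symm (v i)), ?_⟩
      ext1 i
      simp only [LinearMap.pi_apply, LinearMap.comp_apply, LinearEquiv.coe_coe]
      rw [← LinearEquiv.eq_symm_apply, map_sum]
      ext n
      simp only [coeff_sum, Finsupp.coe_finsetSum, Finset.sum_apply, coeff_mapX,
        LinearMap.proj_apply, LinearMap.coe_single]
      rw [Finset.sum_eq_single i]
      · simp
      · intro j _ hj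
        simp [hj.symm]
      · simp

end PolynomialModule

theorem HasFreeRes.polynomialModule {R : Type u} [CommRing R] {n : ℕ} :
    ∀ {M : Type u} [AddCommGroup M] [Module R M],
      HasFreeRes R n M → HasFreeRes R[X] n (PolynomialModule R M) := by
  induction n with
  | zero =>
    intro M _ _ h
    have : Subsingleton M := h
    exact inferInstanceAs (Subsingleton (PolynomialModule R M))
  | succ n ih =>
    rintro M _ _ ⟨r, φ, hφ, hK⟩
    exact of_exact (PolynomialModule.piEquiv R r)
      (PolynomialModule.mapX (LinearMap.ker φ).subtype) (PolynomialModule.mapX φ)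
      (PolynomialModule.mapX_injective Subtype.val_injective)
      (PolynomialModule.mapX_exact (LinearMap.exact_subtype_ker_map φ))
      (PolynomialModule.mapX_surjective hφ) (ih hK)

end PolynomialExtension

section HilbertSyzygy

open Polynomial

universe u

namespace PolynomialModule

variable {R : Type*} [CommRing R] {M F : Type*} [AddCommGroup M] [Module R M]
  [AddCommGroup F] [Module R F] [Module R[X] F] [IsScalarTower R R[X] F]

/-- The `R[X]`-linear extension `M[X] → F` of an `R`-linear map `M → F`. -/
def liftX (f : M →ₗ[R] F) : PolynomialModule R M →ₗ[R[X]] F where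
  toFun p := eval (X : R[X]) (map R[X] f p)
  map_add' := by simp
  map_smul' p q := by
    rw [map_smul, eval_smul, Polynomial.algebraMap_eq, Polynomial.eval_map, eval₂_C_X,
      RingHom.id_apply]

theorem liftX_single (f : M →ₗ[R] F) (n : ℕ) (m : M) :
    liftX f (single R n m) = (X : R[X]) ^ n • f m := by
  simp [liftX]

theorem eq_sum_single {p : PolynomialModule R M} {n : ℕ} (hp : ∀ i, n ≤ i → p.coeff i = 0) :
    p = ∑ i ∈ Finset.range n, single R i (p.coeff i) := by
  ext k
  rw [coeff_sum, Finsupp.coe_finsetSum, Finset.sum_apply]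
  by_cases hk : k < n
  · rw [Finset.sum_eq_single_of_mem k (by simpa using hk)]
    · simp
    · intro b _ hb
      simp [hb.symm]
  · rw [hp k (by omega), Finset.sum_eq_zero]
    intro b hb
    have : b ≠ k := by
      have := Finset.mem_range.1 hb
      omega
    simp [this.symm]

theorem X_smul_coeff_zero (p : PolynomialModule R M) :
    ((X : R[X]) • p).coeff 0 = 0 := by
  rw [← monomial_one_one_eq_X, monomial_smul_apply]
  simp

theorem X_smul_coeff_succ (p : PolynomialModule R M) (n : ℕ) :
    ((X : R[X]) • p).coeff (n + 1) = p.coeff n := by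
  rw [← monomial_one_one_eq_X, monomial_smul_apply]
  simp

theorem X_smul_single (n : ℕ) (m : M) :
    (X : R[X]) • single R n m = single R (n + 1) m := by
  rw [← monomial_one_one_eq_X, monomial_smul_single, one_smul, add_comm]

end PolynomialModule

namespace Submodule

variable {R : Type*} [CommRing R] {s : ℕ} (N : Submodule R[X] (Fin s → R[X]))

/-- The elements of `N` all of whose coordinates have degree less than `j`. -/
def degLT (j : ℕ) : Submodule R (Fin s → R[X]) :=
  N.restrictScalars R ⊓ Submodule.pi Set.univ fun _ => degreeLT R j

variable {N} in
theorem mem_degLT {j : ℕ} {v : Fin s → R[X]} :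
    v ∈ N.degLT j ↔ v ∈ N ∧ ∀ i k, j ≤ k → (v i).coeff k = 0 := by
  simp [degLT, Submodule.mem_pi, Polynomial.mem_degreeLT, Polynomial.degree_lt_iff_coeff_zero]

theorem degLT_mono {j k : ℕ} (h : j ≤ k) : N.degLT j ≤ N.degLT k := fun _ hv =>
  mem_degLT.2 ⟨(mem_degLT.1 hv).1, fun i l hl => (mem_degLT.1 hv).2 i l (h.trans hl)⟩

instance finite_degLT [IsNoetherianRing R] (j : ℕ) : Module.Finite R (N.degLT j) := by
  let c : N.degLT j →ₗ[R] (Fin s → Fin j → R) :=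
    LinearMap.pi fun i => LinearMap.pi fun k =>
      (Polynomial.lcoeff R k) ∘ₗ (LinearMap.proj i : (Fin s → R[X]) →ₗ[R] R[X]) ∘ₗ
        (N.degLT j).subtype
  refine Module.Finite.of_injective c fun v w h => ?_
  ext i k
  by_cases hk : k < j
  · exact congrFun (congrFun h i) ⟨k, hk⟩
  · rw [(mem_degLT.1 v.2).2 i k (by omega), (mem_degLT.1 w.2).2 i k (by omega)]

/-- Multiplication by `X` raises the degree by one. -/
def degLTMulX (j : ℕ) : N.degLT j →ₗ[R] N.degLT (j + 1) where
  toFun v := ⟨(X : R[X]) • v.1, mem_degLT.2 ⟨N.smul_mem _ (mem_degLT.1 v.2).1, by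
    rintro i (_ | k) hk
    · omega
    · simpa [Polynomial.coeff_X_mul] using (mem_degLT.1 v.2).2 i k (by omega)⟩⟩
  map_add' v w := by ext1; exact smul_add _ _ _
  map_smul' c v := by ext1; exact smul_comm _ _ _

/-- The map `p ↦ X p - x p` from `N_{<j}[X]` to `N_{<j+1}[X]`, where `x` is the action of the
variable on `N`. -/
def degLTRel (j : ℕ) :
    PolynomialModule R (N.degLT j) →ₗ[R[X]] PolynomialModule R (N.degLT (j + 1)) :=
  (X : R[X]) • PolynomialModule.mapX (Submodule.inclusion (N.degLT_mono j.le_succ)) -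
    PolynomialModule.mapX (N.degLTMulX j)

/-- The evaluation map `N_{<j}[X] → N`. -/
def degLTEval (j : ℕ) : PolynomialModule R (N.degLT j) →ₗ[R[X]] N :=
  (PolynomialModule.liftX (N.degLT j).subtype).codRestrict N fun p => by
    induction p using PolynomialModule.induction_linear with
    | zero => simp
    | add p q hp hq => rw [map_add]; exact N.add_mem hp hq
    | single n m =>
      rw [PolynomialModule.liftX_single]
      exact N.smul_mem _ (mem_degLT.1 m.2).1

theorem coe_degLTEval (j : ℕ) (p : PolynomialModule R (N.degLT j)) :
    (N.degLTEval j p : Fin s → R[X]) = PolynomialModule.liftX (N.degLT j).subtype p := rfl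

theorem degLTRel_single (j n : ℕ) (m : N.degLT j) :
    N.degLTRel j (PolynomialModule.single R n m) =
      PolynomialModule.single R (n + 1) (Submodule.inclusion (N.degLT_mono j.le_succ) m) -
        PolynomialModule.single R n (N.degLTMulX j m) := by
  rw [degLTRel, LinearMap.sub_apply, LinearMap.smul_apply, PolynomialModule.mapX_single,
    PolynomialModule.mapX_single, PolynomialModule.X_smul_single]

theorem degLTEval_degLTRel (j : ℕ) (p : PolynomialModule R (N.degLT j)) :
    N.degLTEval (j + 1) (N.degLTRel j p) = 0 := by
  induction p using PolynomialModule.induction_linear with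
  | zero => simp
  | add p q hp hq => rw [map_add, map_add, hp, hq, add_zero]
  | single n m =>
    ext1
    rw [degLTRel_single, coe_degLTEval, map_sub, PolynomialModule.liftX_single,
      PolynomialModule.liftX_single, pow_succ, mul_smul]
    exact sub_self _

theorem degLTRel_injective (j : ℕ) : Function.Injective (N.degLTRel j) := by
  have hX (v : N.degLT j) (hv : N.degLTMulX j v = 0) : v = 0 := by
    have h : (X : R[X]) • v.1 = 0 := congrArg Subtype.val hv
    ext i k
    have := congrArg (fun q => q.coeff (k + 1)) (congrFun h i)
    simpa [Polynomial.coeff_X_mul] using this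
  rw [injective_iff_map_eq_zero]
  intro p hp
  have h (n) : ((X : R[X]) • PolynomialModule.mapX
      (Submodule.inclusion (N.degLT_mono j.le_succ)) p).coeff n = N.degLTMulX j (p.coeff n) := by
    have := congrArg (fun q => q.coeff n) hp
    exact sub_eq_zero.1 this
  ext1
  ext1 n
  induction n with
  | zero =>
    apply hX
    rw [← h, PolynomialModule.X_smul_coeff_zero]
  | succ n ih =>
    apply hX
    rw [← h, PolynomialModule.X_smul_coeff_succ, PolynomialModule.coeff_mapX, ih]
    exact map_zero _

theorem mem_range_degLTRel (j : ℕ) (n : ℕ) :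
    ∀ p : PolynomialModule R (N.degLT (j + 1)), (∀ i, n ≤ i → p.coeff i = 0) →
      N.degLTEval (j + 1) p = 0 → p ∈ LinearMap.range (N.degLTRel j) := by
  induction n with
  | zero =>
    intro p hp _
    have : p = 0 := by
      ext1
      ext1 i
      exact hp i i.zero_le
    rw [this]
    exact zero_mem _
  | succ n ih =>
    intro p hp h0
    have hsum : ∑ i ∈ Finset.range (n + 1), (X : R[X]) ^ i • (p.coeff i).1 = 0 := by
      have := congrArg Subtype.val h0
      rw [coe_degLTEval, PolynomialModule.eq_sum_single hp, map_sum] at this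
      simp only [PolynomialModule.liftX_single] at this
      exact this
    rcases n with _ | n
    · refine ih p (fun i _ => ?_) h0
      rcases i with _ | i
      · ext1
        simpa using hsum
      · exact hp _ (by omega)
    · have hm : (p.coeff (n + 1)).1 ∈ N.degLT j := by
        refine mem_degLT.2 ⟨(mem_degLT.1 (p.coeff (n + 1)).2).1, fun i k hk => ?_⟩
        rcases hk.eq_or_lt with rfl | hk
        · have := congrArg (fun q => q.coeff (j + (n + 1))) (congrFun hsum i)
          rw [Finset.sum_range_succ] at this
          simp only [Pi.add_apply, Finset.sum_apply, Pi.smul_apply, smul_eq_mul, coeff_add,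
            finsetSum_coeff, Polynomial.coeff_X_pow_mul, Pi.zero_apply, coeff_zero] at this
          rw [Finset.sum_eq_zero, zero_add] at this
          · exact this
          · intro l hl
            have hl := Finset.mem_range.1 hl
            rw [Polynomial.coeff_X_pow_mul', if_pos (by omega)]
            exact (mem_degLT.1 (p.coeff l).2).2 i _ (by omega)
        · exact (mem_degLT.1 (p.coeff (n + 1)).2).2 i k hk
      let m : N.degLT j := ⟨_, hm⟩
      let t := N.degLTRel j (PolynomialModule.single R n m)
      have hmem : p - t ∈ LinearMap.range (N.degLTRel j) := by
        refine ih _ (fun i hi => ?_) ?_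
        · have ht : t.coeff i = (PolynomialModule.single R (n + 1) (p.coeff (n + 1))).coeff i -
              (PolynomialModule.single R n (N.degLTMulX j m)).coeff i := by
            simp only [t, degLTRel_single]
            rfl
          change p.coeff i - t.coeff i = 0
          rw [ht]
          rcases hi.eq_or_lt with rfl | hi
          · simp
          · rw [hp i (by omega)]
            have h1 : n + 1 ≠ i := by omega
            have h2 : n ≠ i := by omega
            simp [h1, h2]
        · rw [map_sub, h0, degLTEval_degLTRel, sub_zero]
      rw [← sub_add_cancel p t]
      exact add_mem hmem (LinearMap.mem_range_self _ _)

theorem degLT_exact (j : ℕ) : Function.Exact (N.degLTRel j) (N.degLTEval (j + 1)) := by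
  intro p
  constructor
  · intro hp
    refine N.mem_range_degLTRel j (p.coeff.support.sup id + 1) p (fun i hi => ?_) hp
    by_contra h
    have := Finset.le_sup (f := id) (Finsupp.mem_support_iff.2 h)
    simp only [id] at this
    omega
  · rintro ⟨q, rfl⟩
    exact N.degLTEval_degLTRel j q

theorem exists_degLTEval_surjective (hN : N.FG) :
    ∃ j, ∀ k, j ≤ k → Function.Surjective (N.degLTEval k) := by
  obtain ⟨G, hG⟩ := hN
  refine ⟨G.sup fun v => Finset.univ.sup fun i => (v i).natDegree + 1, fun k hk => ?_⟩
  suffices h : N ≤ LinearMap.range (PolynomialModule.liftX (N.degLT k).subtype) by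
    rintro ⟨v, hv⟩
    obtain ⟨p, hp⟩ := h hv
    exact ⟨p, Subtype.ext hp⟩
  conv_lhs => rw [← hG]
  refine Submodule.span_le.2 fun v hv => ?_
  have hvk : v ∈ N.degLT k := by
    refine mem_degLT.2 ⟨hG ▸ Submodule.subset_span hv, fun i l hl => ?_⟩
    refine Polynomial.coeff_eq_zero_of_natDegree_lt ?_
    have h1 := Finset.le_sup (f := fun v : Fin s → R[X] =>
      Finset.univ.sup fun i => (v i).natDegree + 1) hv
    have h2 := Finset.le_sup (f := fun i => (v i).natDegree + 1) (Finset.mem_univ i)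
    omega
  exact ⟨PolynomialModule.single R 0 ⟨v, hvk⟩, by simp [PolynomialModule.liftX_single]⟩

end Submodule

/-- Every finitely generated `R`-module has a finite resolution by free modules of finite rank. -/
def AllHaveFreeRes (R : Type u) [CommRing R] : Prop :=
  ∀ (M : Type u) [AddCommGroup M] [Module R M] [Module.Finite R M], ∃ n, HasFreeRes R n M

namespace AllHaveFreeRes

theorem polynomial {R : Type u} [CommRing R] [IsNoetherianRing R] (h : AllHaveFreeRes R) :
    AllHaveFreeRes R[X] := by
  intro M _ _ _
  obtain ⟨s, φ, hφ⟩ := Module.Finite.exists_fin' R[X] M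
  set N := LinearMap.ker φ with hN
  obtain ⟨j, hj⟩ := N.exists_degLTEval_surjective (IsNoetherian.noetherian N)
  obtain ⟨n, hn⟩ := h (N.degLT j)
  obtain ⟨m, hm⟩ := h (N.degLT (j + 1))
  exact ⟨max n m + 1 + 1, s, φ, hφ, HasFreeRes.cokernel (N.degLTRel j) (N.degLTEval (j + 1))
    (N.degLTRel_injective j) (N.degLT_exact j) (hj _ j.le_succ)
    (hn.polynomialModule.mono (le_max_left n m))
    (hm.polynomialModule.mono ((le_max_right n m).trans (Nat.le_succ _)))⟩

theorem of_ringEquiv {R S : Type u} [CommRing R] [CommRing S] (e : R ≃+* S)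
    (h : AllHaveFreeRes R) : AllHaveFreeRes S := by
  intro M _ _ _
  let _ : Module R M := Module.compHom M (e : R →+* S)
  have hsmul (a : R) (m : M) : a • m = e a • m := rfl
  have : Module.Finite R M := by
    obtain ⟨G, hG⟩ := Module.Finite.fg_top (R := S) (M := M)
    refine ⟨⟨G, ?_⟩⟩
    rw [eq_top_iff]
    intro m _
    have hm : m ∈ Submodule.span S (G : Set M) := hG ▸ Submodule.mem_top
    induction hm using Submodule.span_induction with
    | mem x hx => exact Submodule.subset_span hx
    | zero => exact zero_mem _
    | add x y _ _ hx hy => exact add_mem (hx trivial) (hy trivial)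
    | smul a x _ hx =>
      have := Submodule.smul_mem _ (e.symm a) (hx trivial)
      rwa [hsmul, e.apply_symm_apply] at this
  obtain ⟨n, hn⟩ := h M
  exact ⟨n, HasFreeRes.of_semilinear e n (AddEquiv.refl M) hsmul hn⟩

theorem field (k : Type u) [Field k] : AllHaveFreeRes k := by
  intro M _ _ _
  let e := (Module.finBasis k M).equivFun.symm
  refine ⟨1, _, e.toLinearMap, e.surjective, ?_⟩
  rw [LinearEquiv.ker]
  exact inferInstanceAs (Subsingleton (⊥ : Submodule k _))

/-- **Hilbert's syzygy theorem** for finitely generated modules over `k[z₁,…,z_d]`. -/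
theorem mvPolynomial (k : Type u) [Field k] (d : ℕ) :
    AllHaveFreeRes (MvPolynomial (Fin d) k) := by
  induction d with
  | zero => exact (field k).of_ringEquiv (MvPolynomial.isEmptyRingEquiv k (Fin 0)).symm
  | succ d ih =>
    exact ih.polynomial.of_ringEquiv (MvPolynomial.finSuccEquiv k d).symm.toRingEquiv

end AllHaveFreeRes

end HilbertSyzygy

section Conversion

theorem IsFreeResolution.cons {d : ℕ} {M : Type*} [AddCommGroup M] [Module (PolyA d) M]
    {n m : ℕ} {r : ℕ → ℕ} (φ : (Fin m → PolyA d) →ₗ[PolyA d] M) (hφ : Function.Surjective φ)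
    {δ : ∀ k : ℕ, (Fin (r (k + 2)) → PolyA d) →ₗ[PolyA d] (Fin (r (k + 1)) → PolyA d)}
    {ε : (Fin (r 1) → PolyA d) →ₗ[PolyA d] LinearMap.ker φ}
    (h : IsFreeResolution d (LinearMap.ker φ) n r δ ε) :
    ∃ (r : ℕ → ℕ)
      (δ : ∀ k : ℕ, (Fin (r (k + 2)) → PolyA d) →ₗ[PolyA d] (Fin (r (k + 1)) → PolyA d))
      (ε : (Fin (r 1) → PolyA d) →ₗ[PolyA d] M), IsFreeResolution d M (n + 1) r δ ε := by
  obtain ⟨hε, hδ0, hδ, hr⟩ := h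
  let r' : ℕ → ℕ := fun | 0 => 0 | 1 => m | k + 2 => r (k + 1)
  let δ' : ∀ k : ℕ, (Fin (r' (k + 2)) → PolyA d) →ₗ[PolyA d] (Fin (r' (k + 1)) → PolyA d) :=
    fun | 0 => (LinearMap.ker φ).subtype ∘ₗ ε | k + 1 => δ k
  refine ⟨r', δ', φ, hφ, ?_, ?_, ?_⟩
  · change LinearMap.range ((LinearMap.ker φ).subtype ∘ₗ ε) = LinearMap.ker φ
    rw [LinearMap.range_comp_of_range_eq_top _ (LinearMap.range_eq_top.2 hε),
      Submodule.range_subtype]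
  · rintro (_ | k)
    · change LinearMap.range (δ 0) = LinearMap.ker ((LinearMap.ker φ).subtype ∘ₗ ε)
      rw [LinearMap.ker_comp_of_ker_eq_bot _ (Submodule.ker_subtype _), hδ0]
    · exact hδ k
  · rintro (_ | _ | k) hk
    · rfl
    · omega
    · exact hr (k + 1) (by omega)

theorem HasFreeRes.exists_isFreeResolution {d n : ℕ} :
    ∀ {M : Type} [AddCommGroup M] [Module (PolyA d) M], HasFreeRes (PolyA d) n M →
    ∃ (r : ℕ → ℕ)
      (δ : ∀ k : ℕ, (Fin (r (k + 2)) → PolyA d) →ₗ[PolyA d] (Fin (r (k + 1)) → PolyA d))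
      (ε : (Fin (r 1) → PolyA d) →ₗ[PolyA d] M), IsFreeResolution d M n r δ ε := by
  induction n with
  | zero =>
    intro M _ _ h
    have : Subsingleton M := h
    refine ⟨fun _ => 0, fun _ => 0, 0, fun y => ⟨0, Subsingleton.elim _ _⟩, ?_, fun k => ?_,
      fun _ _ => rfl⟩ <;> exact Subsingleton.elim _ _
  | succ n ih =>
    rintro M _ _ ⟨m, φ, hφ, hK⟩
    obtain ⟨r, δ, ε, h⟩ := ih hK
    exact h.cons φ hφ

theorem exists_isFreeResolution (d : ℕ) (M : Type*) [AddCommGroup M] [Module (PolyA d) M]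
    [Module.Finite (PolyA d) M] :
    ∃ (n : ℕ) (r : ℕ → ℕ)
      (δ : ∀ k : ℕ, (Fin (r (k + 2)) → PolyA d) →ₗ[PolyA d] (Fin (r (k + 1)) → PolyA d))
      (ε : (Fin (r 1) → PolyA d) →ₗ[PolyA d] M), IsFreeResolution d M n r δ ε := by
  obtain ⟨m, φ, hφ⟩ := Module.Finite.exists_fin' (PolyA d) M
  obtain ⟨n, hn⟩ := AllHaveFreeRes.mvPolynomial ℂ d (LinearMap.ker φ)
  obtain ⟨r, δ, ε, h⟩ := hn.exists_isFreeResolution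
  exact ⟨n + 1, h.cons φ hφ⟩

end Conversion

section KoszulSign

variable {d : ℕ}

/-- The sign with which `c_k` produces the index set `S`. -/
def kozSign (S : Finset (Fin d)) (k : Fin d) : ℂ :=
  (-1) ^ (S.filter (fun j => j < k)).card

theorem kozSign_mul_self (S : Finset (Fin d)) (k : Fin d) : kozSign S k * kozSign S k = 1 := by
  rw [kozSign, ← mul_pow]
  simp

theorem kozSign_insert {S : Finset (Fin d)} {k : Fin d} (hk : k ∉ S) (j : Fin d) :
    kozSign (insert k S) j = if k < j then -kozSign S j else kozSign S j := by
  rw [kozSign, kozSign, Finset.filter_insert]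
  split_ifs with h
  · rw [Finset.card_insert_of_notMem (by simp [hk]), pow_succ, mul_neg_one]
  · rfl

theorem kozSign_erase {S : Finset (Fin d)} {k : Fin d} (hk : k ∈ S) (j : Fin d) :
    kozSign (S.erase k) j = if k < j then -kozSign S j else kozSign S j := by
  have := kozSign_insert (Finset.notMem_erase k S) j
  rw [Finset.insert_erase hk] at this
  rw [this]
  split_ifs <;> simp

variable {V : Type*} [AddCommGroup V] [Module ℂ V] (T : Fin d → V →ₗ[ℂ] V)

theorem kozB_apply (f : Finset (Fin d) → V) (S : Finset (Fin d)) :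
    kozB d T f S = ∑ k : Fin d, if k ∈ S then kozSign S k • T k (f (S.erase k)) else 0 := rfl

variable {T}

theorem kozB_kozB (hT : ∀ i j x, T i (T j x) = T j (T i x)) (f : Finset (Fin d) → V) :
    kozB d T (kozB d T f) = 0 := by
  funext S
  let G : Fin d → Fin d → V := fun k j =>
    if k ∈ S ∧ j ∈ S ∧ j ≠ k then
      (kozSign S k * kozSign (S.erase k) j) • T k (T j (f ((S.erase k).erase j))) else 0
  have hG : kozB d T (kozB d T f) S = ∑ k, ∑ j, G k j := by
    rw [kozB_apply]
    refine Finset.sum_congr rfl fun k _ => ?_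
    by_cases hk : k ∈ S
    · rw [if_pos hk, kozB_apply, map_sum, Finset.smul_sum]
      refine Finset.sum_congr rfl fun j _ => ?_
      by_cases hj : j ∈ S.erase k
      · have hj' := Finset.mem_erase.1 hj
        rw [if_pos hj, map_smul, smul_smul]
        simp only [G, hk, hj'.1, hj'.2, ne_eq, not_false_eq_true, and_self, if_true]
      · rw [if_neg hj, map_zero, smul_zero]
        simp only [G]
        rw [if_neg]
        rintro ⟨_, h1, h2⟩
        exact hj (Finset.mem_erase.2 ⟨h2, h1⟩)
    · simp [hk, G]
  have hanti (k j) : G k j = -G j k := by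
    by_cases h : k ∈ S ∧ j ∈ S ∧ j ≠ k
    · obtain ⟨hk, hj, hne⟩ := h
      simp only [G, hk, hj, hne, hne.symm, ne_eq, not_false_eq_true, and_self, if_true]
      rw [hT, Finset.erase_right_comm, ← neg_smul, kozSign_erase hk, kozSign_erase hj]
      congr 1
      rcases hne.lt_or_gt with h | h
      · rw [if_neg h.not_gt, if_pos h]; ring
      · rw [if_pos h, if_neg h.not_gt]; ring
    · have h' : ¬(j ∈ S ∧ k ∈ S ∧ k ≠ j) := fun ⟨h1, h2, h3⟩ => h ⟨h2, h1, h3.symm⟩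
      simp only [G, if_neg h, if_neg h', neg_zero]
  have h2 : ∑ k, ∑ j, G k j = -∑ k, ∑ j, G k j := by
    conv_lhs => rw [Finset.sum_comm]
    simp only [← Finset.sum_neg_distrib]
    exact Finset.sum_congr rfl fun j _ => Finset.sum_congr rfl fun k _ => hanti k j
  rw [hG]
  have h3 : (2 : ℂ) • ∑ k, ∑ j, G k j = 0 := by
    rw [two_smul]
    exact eq_neg_iff_add_eq_zero.1 h2
  exact (smul_eq_zero.1 h3).resolve_left two_ne_zero

theorem eq_zero_of_mem_degSub {k : ℕ} (hk : d < k) {f : Finset (Fin d) → V}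
    (hf : f ∈ degSub d V k) : f = 0 := by
  funext S
  refine hf S ?_
  have := S.card_le_univ
  rw [Fintype.card_fin] at this
  omega

theorem kozB_mem_degSub {k : ℕ} {f : Finset (Fin d) → V} (hf : f ∈ degSub d V k) :
    kozB d T f ∈ degSub d V (k + 1) := by
  intro S hS
  rw [kozB_apply]
  refine Finset.sum_eq_zero fun j _ => ?_
  split_ifs with hj
  · rw [hf, map_zero, smul_zero]
    have := Finset.card_erase_add_one hj
    omega
  · rfl

theorem mem_kozZ_top {k : ℕ} {f : Finset (Fin d) → V} :
    f ∈ kozZ d T ⊤ k ↔ kozB d T f = 0 ∧ f ∈ degSub d V k := by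
  simp [kozZ, inSub]

theorem mem_kozCob_top {k : ℕ} {f : Finset (Fin d) → V} :
    f ∈ kozCob d T ⊤ k ↔ ∃ g ∈ degSub d V (k - 1), kozB d T g = f := by
  simp [kozCob, inSub]

theorem eq_zero_of_mem_kozCob_zero {f : Finset (Fin d) → V} (hf : f ∈ degSub d V 0)
    (hf' : f ∈ kozCob d T ⊤ 0) : f = 0 := by
  obtain ⟨g, hg, rfl⟩ := mem_kozCob_top.1 hf'
  funext S
  by_cases hS : S.card = 0
  · exact kozB_mem_degSub hg S (by omega)
  · exact hf S hS

theorem subsingleton_kozH {k : ℕ} (hk : d < k) : Subsingleton (kozH d T ⊤ k) := by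
  refine Submodule.Quotient.subsingleton_iff.2 (eq_top_iff.2 fun z _ => ?_)
  rw [Submodule.mem_comap, Submodule.subtype_apply,
    eq_zero_of_mem_degSub hk (mem_kozZ_top.1 z.2).2]
  exact zero_mem _

theorem finite_kozH (h : KozFiniteType d T ⊤) (k : ℕ) : FiniteDimensional ℂ (kozH d T ⊤ k) := by
  rcases le_or_gt k d with hk | hk
  · exact h k hk
  · have := subsingleton_kozH (T := T) hk
    infer_instance

end KoszulSign

section KoszulMap

variable {d : ℕ} {V W : Type*} [AddCommGroup V] [Module ℂ V] [AddCommGroup W] [Module ℂ W]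
  {T : Fin d → V →ₗ[ℂ] V} {U : Fin d → W →ₗ[ℂ] W} {φ : V →ₗ[ℂ] W}

theorem kozB_compLeft (hφ : ∀ i x, φ (T i x) = U i (φ x)) (f : Finset (Fin d) → V) :
    kozB d U (φ.compLeft _ f) = φ.compLeft _ (kozB d T f) := by
  funext S
  rw [LinearMap.compLeft_apply, Function.comp_apply, kozB_apply, kozB_apply, map_sum]
  refine Finset.sum_congr rfl fun k _ => ?_
  split_ifs
  · rw [map_smul, hφ]
    rfl
  · rw [map_zero]

theorem compLeft_mem_degSub {k : ℕ} {f : Finset (Fin d) → V} (hf : f ∈ degSub d V k) :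
    φ.compLeft _ f ∈ degSub d W k := by
  intro S hS
  rw [LinearMap.compLeft_apply, Function.comp_apply, hf S hS, map_zero]

/-- The map on Koszul cohomology induced by a linear map intertwining the operators. -/
def kozMap (hφ : ∀ i x, φ (T i x) = U i (φ x)) (k : ℕ) :
    kozH d T ⊤ k →ₗ[ℂ] kozH d U ⊤ k :=
  Submodule.mapQ _ _ ((φ.compLeft (Finset (Fin d))).restrict fun f hf => mem_kozZ_top.2
      ⟨by rw [kozB_compLeft hφ, (mem_kozZ_top.1 hf).1, map_zero],
        compLeft_mem_degSub (mem_kozZ_top.1 hf).2⟩) <| by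
    rintro ⟨z, hz⟩ h
    obtain ⟨g, hg, hgz⟩ := mem_kozCob_top.1 h
    exact mem_kozCob_top.2 ⟨φ.compLeft _ g, compLeft_mem_degSub hg, by
      rw [kozB_compLeft hφ, hgz]; rfl⟩

/-- The cohomology class of a cocycle. -/
def kozCls (T : Fin d → V →ₗ[ℂ] V) (k : ℕ) : kozZ d T ⊤ k →ₗ[ℂ] kozH d T ⊤ k :=
  Submodule.mkQ _

theorem kozCls_surjective (k : ℕ) : Function.Surjective (kozCls T k) := Submodule.mkQ_surjective _

theorem kozCls_eq_zero {k : ℕ} {z : kozZ d T ⊤ k} : kozCls T k z = 0 ↔ z.1 ∈ kozCob d T ⊤ k := by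
  rw [kozCls, Submodule.mkQ_apply, Submodule.Quotient.mk_eq_zero]
  rfl

theorem kozMap_kozCls (hφ : ∀ i x, φ (T i x) = U i (φ x)) {k : ℕ} {z : kozZ d T ⊤ k}
    {w : kozZ d U ⊤ k} (h : φ.compLeft _ z.1 = w.1) :
    kozMap hφ k (kozCls T k z) = kozCls U k w := by
  have : w = (φ.compLeft (Finset (Fin d))).restrict (fun f hf => mem_kozZ_top.2
      ⟨by rw [kozB_compLeft hφ, (mem_kozZ_top.1 hf).1, map_zero],
        compLeft_mem_degSub (mem_kozZ_top.1 hf).2⟩) z := Subtype.ext h.symm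
  rw [this]
  rfl

theorem exists_kozMap_kozCls (hφ : ∀ i x, φ (T i x) = U i (φ x)) {k : ℕ} (z : kozZ d T ⊤ k) :
    ∃ w : kozZ d U ⊤ k, w.1 = φ.compLeft _ z.1 ∧ kozMap hφ k (kozCls T k z) = kozCls U k w :=
  ⟨⟨φ.compLeft _ z.1, mem_kozZ_top.2 ⟨by rw [kozB_compLeft hφ, (mem_kozZ_top.1 z.2).1, map_zero],
        compLeft_mem_degSub (mem_kozZ_top.1 z.2).2⟩⟩, rfl, kozMap_kozCls hφ rfl⟩

end KoszulMap

section KoszulExact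

variable {d : ℕ} {V' V V'' : Type*} [AddCommGroup V'] [Module ℂ V'] [AddCommGroup V] [Module ℂ V]
  [AddCommGroup V''] [Module ℂ V''] {T' : Fin d → V' →ₗ[ℂ] V'} {T : Fin d → V →ₗ[ℂ] V}
  {T'' : Fin d → V'' →ₗ[ℂ] V''} {φ : V' →ₗ[ℂ] V} {ψ : V →ₗ[ℂ] V''}

theorem compLeft_injective (hinj : Function.Injective φ) :
    Function.Injective (φ.compLeft (Finset (Fin d))) := by
  intro f g h
  funext S
  exact hinj (congrFun h S)

theorem mem_degSub_of_compLeft (hinj : Function.Injective φ) {k : ℕ} {f : Finset (Fin d) → V'}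
    (h : φ.compLeft _ f ∈ degSub d V k) : f ∈ degSub d V' k := by
  intro S hS
  apply hinj
  rw [map_zero]
  exact h S hS

theorem exists_compLeft_of_exact (hinj : Function.Injective φ) (hex : Function.Exact φ ψ) {k : ℕ}
    {f : Finset (Fin d) → V} (hf : f ∈ degSub d V k) (h0 : ψ.compLeft _ f = 0) :
    ∃ g ∈ degSub d V' k, φ.compLeft _ g = f := by
  choose g hg using fun S => (hex (f S)).1 (congrFun h0 S)
  have hgf : φ.compLeft _ g = f := funext hg
  exact ⟨g, mem_degSub_of_compLeft hinj (hgf ▸ hf), hgf⟩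

theorem exists_compLeft_of_surjective (hsurj : Function.Surjective ψ) {k : ℕ}
    {f : Finset (Fin d) → V''} (hf : f ∈ degSub d V'' k) :
    ∃ g ∈ degSub d V k, ψ.compLeft _ g = f := by
  choose g hg using fun S => hsurj (f S)
  refine ⟨fun S => if S.card = k then g S else 0, fun S hS => if_neg hS, funext fun S => ?_⟩
  rw [LinearMap.compLeft_apply, Function.comp_apply]
  split_ifs with h
  · exact hg S
  · rw [map_zero, hf S h]

theorem kozMap_zero_injective (hφ : ∀ i x, φ (T' i x) = T i (φ x))
    (hinj : Function.Injective φ) : Function.Injective (kozMap hφ 0) := by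
  rw [injective_iff_map_eq_zero]
  intro x hx
  obtain ⟨z, rfl⟩ := kozCls_surjective 0 x
  obtain ⟨w, hw, hw'⟩ := exists_kozMap_kozCls hφ z
  rw [hw', kozCls_eq_zero] at hx
  have hz : z = 0 := by
    ext1
    apply compLeft_injective hinj
    rw [← hw, eq_zero_of_mem_kozCob_zero (mem_kozZ_top.1 w.2).2 hx]
    exact (map_zero _).symm
  rw [hz, map_zero]

theorem kozMap_exact (hT : ∀ i j x, T i (T j x) = T j (T i x))
    (hφ : ∀ i x, φ (T' i x) = T i (φ x)) (hψ : ∀ i x, ψ (T i x) = T'' i (ψ x))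
    (hinj : Function.Injective φ) (hex : Function.Exact φ ψ) (hsurj : Function.Surjective ψ)
    (k : ℕ) : Function.Exact (kozMap hφ k) (kozMap hψ k) := by
  intro x
  obtain ⟨z, rfl⟩ := kozCls_surjective k x
  constructor
  · intro hx
    obtain ⟨w, hw, hw'⟩ := exists_kozMap_kozCls hψ z
    rw [hw', kozCls_eq_zero, hw] at hx
    have hz := mem_kozZ_top.1 z.2
    obtain ⟨b, hb, hbd, hbz⟩ : ∃ b ∈ kozCob d T ⊤ k, b ∈ degSub d V k ∧
        ψ.compLeft _ b = ψ.compLeft _ z.1 := by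
      rcases k with _ | k
      · refine ⟨0, zero_mem _, zero_mem _, ?_⟩
        rw [eq_zero_of_mem_kozCob_zero (compLeft_mem_degSub hz.2) hx, map_zero]
      · obtain ⟨y, hy, hyz⟩ := mem_kozCob_top.1 hx
        obtain ⟨c, hc, rfl⟩ := exists_compLeft_of_surjective hsurj hy
        exact ⟨kozB d T c, mem_kozCob_top.2 ⟨c, hc, rfl⟩, kozB_mem_degSub hc,
          by rw [← hyz, kozB_compLeft hψ]⟩
    have hBb : kozB d T b = 0 := by
      obtain ⟨c, _, rfl⟩ := mem_kozCob_top.1 hb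
      exact kozB_kozB hT c
    obtain ⟨a, ha, haz⟩ := exists_compLeft_of_exact hinj hex (sub_mem hz.2 hbd)
      (by rw [map_sub, hbz, sub_self])
    have haZ : a ∈ kozZ d T' ⊤ k := by
      refine mem_kozZ_top.2 ⟨compLeft_injective hinj ?_, ha⟩
      rw [← kozB_compLeft hφ, haz, map_sub, hz.1, hBb, sub_zero, map_zero]
    have hbZ : b ∈ kozZ d T ⊤ k := mem_kozZ_top.2 ⟨hBb, hbd⟩
    refine ⟨kozCls T' k ⟨a, haZ⟩, ?_⟩
    rw [kozMap_kozCls hφ (w := z - ⟨b, hbZ⟩) haz, map_sub,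
      kozCls_eq_zero.2 (show (⟨b, hbZ⟩ : kozZ d T ⊤ k).1 ∈ _ from hb), sub_zero]
  · rintro ⟨y, hy⟩
    rw [← hy]
    obtain ⟨a, rfl⟩ := kozCls_surjective k y
    obtain ⟨w, hw, hw'⟩ := exists_kozMap_kozCls hφ a
    rw [hw', kozMap_kozCls hψ (w := 0), map_zero]
    rw [hw]
    funext S
    exact hex.apply_apply_eq_zero _

/-- The connecting isomorphism from the cokernel of `H^k(V) → H^k(V'')` to the kernel of
`H^{k+1}(V') → H^{k+1}(V)`. -/
theorem nonempty_connectingEquiv (hT : ∀ i j x, T i (T j x) = T j (T i x))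
    (hφ : ∀ i x, φ (T' i x) = T i (φ x)) (hψ : ∀ i x, ψ (T i x) = T'' i (ψ x))
    (hinj : Function.Injective φ) (hex : Function.Exact φ ψ) (hsurj : Function.Surjective ψ)
    (k : ℕ) : Nonempty ((kozH d T'' ⊤ k ⧸ LinearMap.range (kozMap hψ k)) ≃ₗ[ℂ]
      LinearMap.ker (kozMap hφ (k + 1))) := by
  let F := φ.compLeft (Finset (Fin d))
  let G := ψ.compLeft (Finset (Fin d))
  have hGF (a) : G (F a) = 0 := funext fun S => hex.apply_apply_eq_zero _
  let P : Submodule ℂ (Finset (Fin d) → V) :=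
    degSub d V k ⊓ (LinearMap.range F).comap (kozB d T)
  let e := LinearEquiv.ofInjective F (compLeft_injective hinj)
  let τ : P →ₗ[ℂ] (Finset (Fin d) → V') :=
    e.symm.toLinearMap ∘ₗ (kozB d T).restrict (p := P) (q := LinearMap.range F) fun c hc => hc.2
  have hτ (c : P) : F (τ c) = kozB d T c := by
    have := e.apply_symm_apply ((kozB d T).restrict (p := P) (q := LinearMap.range F)
      (fun c hc => hc.2) c)
    exact congrArg Subtype.val this
  have hτZ (c : P) : τ c ∈ kozZ d T' ⊤ (k + 1) := by
    refine mem_kozZ_top.2 ⟨compLeft_injective hinj ?_, mem_degSub_of_compLeft hinj ?_⟩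
    · change F _ = F 0
      rw [← kozB_compLeft hφ, map_zero]
      change kozB d T (F _) = 0
      rw [hτ, kozB_kozB hT]
    · change F _ ∈ _
      rw [hτ]
      exact kozB_mem_degSub c.2.1
  have hGZ (c : P) : G c ∈ kozZ d T'' ⊤ k := by
    refine mem_kozZ_top.2 ⟨?_, compLeft_mem_degSub c.2.1⟩
    obtain ⟨a, ha⟩ := c.2.2
    rw [kozB_compLeft hψ, ← ha]
    exact hGF a
  have hτker (c : P) : kozCls T' (k + 1) (τ.codRestrict _ hτZ c) ∈
      LinearMap.ker (kozMap hφ (k + 1)) := by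
    obtain ⟨w, hw, hw'⟩ := exists_kozMap_kozCls hφ (τ.codRestrict _ hτZ c)
    rw [LinearMap.mem_ker, hw', kozCls_eq_zero, hw, mem_kozCob_top]
    exact ⟨c, c.2.1, (hτ c).symm⟩
  let α : P →ₗ[ℂ] kozH d T'' ⊤ k ⧸ LinearMap.range (kozMap hψ k) :=
    Submodule.mkQ _ ∘ₗ kozCls T'' k ∘ₗ (G ∘ₗ P.subtype).codRestrict _ hGZ
  let β : P →ₗ[ℂ] LinearMap.ker (kozMap hφ (k + 1)) :=
    (kozCls T' (k + 1) ∘ₗ τ.codRestrict _ hτZ).codRestrict _ hτker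
  have hα : Function.Surjective α := by
    intro y
    obtain ⟨y, rfl⟩ := Submodule.mkQ_surjective _ y
    obtain ⟨z, rfl⟩ := kozCls_surjective k y
    have hz := mem_kozZ_top.1 z.2
    obtain ⟨c, hc, hcz⟩ := exists_compLeft_of_surjective hsurj hz.2
    obtain ⟨a, _, ha⟩ := exists_compLeft_of_exact hinj hex (kozB_mem_degSub (T := T) hc)
      (by rw [← kozB_compLeft hψ, hcz, hz.1])
    refine ⟨⟨c, hc, a, ha⟩, ?_⟩
    have : (G ∘ₗ P.subtype).codRestrict _ hGZ ⟨c, hc, a, ha⟩ = z := Subtype.ext hcz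
    simp only [α, LinearMap.comp_apply, this]
  have hβ : Function.Surjective β := by
    rintro ⟨y, hy⟩
    obtain ⟨z, rfl⟩ := kozCls_surjective (k + 1) y
    obtain ⟨w, hw, hw'⟩ := exists_kozMap_kozCls hφ z
    rw [LinearMap.mem_ker, hw', kozCls_eq_zero, hw, mem_kozCob_top] at hy
    obtain ⟨c, hc, hcz⟩ := hy
    refine ⟨⟨c, hc, z.1, hcz.symm⟩, Subtype.ext ?_⟩
    have : τ.codRestrict _ hτZ ⟨c, hc, z.1, hcz.symm⟩ = z := by
      refine Subtype.ext (compLeft_injective hinj ?_)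
      exact (hτ _).trans hcz
    change kozCls T' (k + 1) (τ.codRestrict _ hτZ _) = _
    rw [this]
  have hker : LinearMap.ker α = LinearMap.ker β := by
    ext c
    have h1 : c ∈ LinearMap.ker α ↔
        kozCls T'' k ⟨G c, hGZ c⟩ ∈ LinearMap.range (kozMap hψ k) := by
      rw [LinearMap.mem_ker]
      exact Submodule.Quotient.mk_eq_zero _
    have h2 : c ∈ LinearMap.ker β ↔ τ c ∈ kozCob d T' ⊤ (k + 1) := by
      rw [LinearMap.mem_ker, Subtype.ext_iff]
      exact kozCls_eq_zero (z := ⟨τ c, hτZ c⟩)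
    rw [h1, h2, mem_kozCob_top]
    constructor
    · rintro ⟨y, hy⟩
      obtain ⟨z, rfl⟩ := kozCls_surjective k y
      obtain ⟨w, hw, hw'⟩ := exists_kozMap_kozCls hψ z
      rw [hw', ← sub_eq_zero, ← map_sub, kozCls_eq_zero] at hy
      replace hy : w.1 - G c ∈ kozCob d T'' ⊤ k := hy
      rw [hw] at hy
      have hz := mem_kozZ_top.1 z.2
      obtain ⟨b, hBb, hbd, hbz⟩ : ∃ b, kozB d T b = 0 ∧ b ∈ degSub d V k ∧
          G b = G z.1 - G c := by
        rcases k with _ | k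
        · refine ⟨0, map_zero _, zero_mem _, ?_⟩
          rw [map_zero]
          exact (eq_zero_of_mem_kozCob_zero (sub_mem (compLeft_mem_degSub hz.2)
            (compLeft_mem_degSub c.2.1)) hy).symm
        · obtain ⟨y, hy, hyz⟩ := mem_kozCob_top.1 hy
          obtain ⟨x, hx, rfl⟩ := exists_compLeft_of_surjective hsurj hy
          refine ⟨kozB d T x, kozB_kozB hT x, kozB_mem_degSub hx, ?_⟩
          rw [← kozB_compLeft hψ, hyz]
      obtain ⟨a, ha, hac⟩ := exists_compLeft_of_exact hinj hex
        (sub_mem (sub_mem c.2.1 hz.2) (neg_mem hbd))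
        (by change G _ = 0; rw [map_sub, map_sub, map_neg, hbz]; abel)
      refine ⟨a, ha, compLeft_injective hinj ?_⟩
      rw [← kozB_compLeft hφ, hac, map_sub, map_sub, map_neg, hz.1, hBb]
      simpa using (hτ c).symm
    · rintro ⟨a, ha, hac⟩
      have hz : c.1 - F a ∈ kozZ d T ⊤ k := by
        refine mem_kozZ_top.2 ⟨?_, sub_mem c.2.1 (compLeft_mem_degSub ha)⟩
        rw [map_sub, kozB_compLeft hφ, hac]
        exact sub_eq_zero.2 (hτ c).symm
      refine ⟨kozCls T k ⟨_, hz⟩, kozMap_kozCls hψ ?_⟩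
      change G (c.1 - F a) = G c.1
      rw [map_sub, hGF, sub_zero]
  exact ⟨(α.quotKerEquivOfSurjective hα).symm.trans
    ((Submodule.quotEquivOfEq _ _ hker).trans (β.quotKerEquivOfSurjective hβ))⟩

theorem KozFiniteType.of_exact (hT : ∀ i j x, T i (T j x) = T j (T i x))
    (hφ : ∀ i x, φ (T' i x) = T i (φ x)) (hψ : ∀ i x, ψ (T i x) = T'' i (ψ x))
    (hinj : Function.Injective φ) (hex : Function.Exact φ ψ) (hsurj : Function.Surjective ψ)
    (h' : KozFiniteType d T' ⊤) (h : KozFiniteType d T ⊤) : KozFiniteType d T'' ⊤ := by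
  intro k _
  have := finite_kozH h' (k + 1)
  have := finite_kozH h k
  obtain ⟨e⟩ := nonempty_connectingEquiv hT hφ hψ hinj hex hsurj k
  have : Module.Finite ℂ (kozH d T'' ⊤ k ⧸ LinearMap.range (kozMap hψ k)) :=
    Module.Finite.equiv e.symm
  exact Module.Finite.of_submodule_quotient (LinearMap.range (kozMap hψ k))

/-- The Euler number is additive on short exact sequences. -/
theorem eulerNum_of_exact (hT : ∀ i j x, T i (T j x) = T j (T i x))
    (hφ : ∀ i x, φ (T' i x) = T i (φ x)) (hψ : ∀ i x, ψ (T i x) = T'' i (ψ x))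
    (hinj : Function.Injective φ) (hex : Function.Exact φ ψ) (hsurj : Function.Surjective ψ)
    (h' : KozFiniteType d T' ⊤) (h : KozFiniteType d T ⊤) :
    eulerNum d T ⊤ = eulerNum d T' ⊤ + eulerNum d T'' ⊤ := by
  have h'' := h'.of_exact hT hφ hψ hinj hex hsurj h
  have := finite_kozH h'
  have := finite_kozH h
  have := finite_kozH h''
  let a : ℕ → ℕ := fun k => Module.finrank ℂ (LinearMap.ker (kozMap hφ k))
  have ha0 : a 0 = 0 := by
    simp only [a]
    rw [LinearMap.ker_eq_bot.2 (kozMap_zero_injective hφ hinj), finrank_bot]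
  have had : a (d + 1) = 0 := by
    have := subsingleton_kozH (T := T') (Nat.lt_succ_self d)
    exact Module.finrank_zero_of_subsingleton
  have hk (k) : (Module.finrank ℂ (kozH d T ⊤ k) : ℤ) = Module.finrank ℂ (kozH d T' ⊤ k) +
      Module.finrank ℂ (kozH d T'' ⊤ k) - a k - a (k + 1) := by
    obtain ⟨e⟩ := nonempty_connectingEquiv hT hφ hψ hinj hex hsurj k
    have h1 := (kozMap hφ k).finrank_range_add_finrank_ker
    have h2 := (kozMap hψ k).finrank_range_add_finrank_ker
    have h3 := (LinearMap.range (kozMap hψ k)).finrank_quotient_add_finrank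
    have h4 := e.finrank_eq
    rw [(kozMap_exact hT hφ hψ hinj hex hsurj k).linearMap_ker_eq] at h2
    simp only [a]
    omega
  have htel (n : ℕ) : ∑ k ∈ Finset.range n, (-1 : ℤ) ^ k * ((a k : ℤ) + a (k + 1)) =
      a 0 - (-1) ^ n * a n := by
    induction n with
    | zero => simp
    | succ n ih => rw [Finset.sum_range_succ, ih, pow_succ]; ring
  have := htel (d + 1)
  rw [ha0, had, Nat.cast_zero, mul_zero, sub_zero] at this
  rw [eulerNum, eulerNum, eulerNum, ← sub_eq_zero, ← Finset.sum_add_distrib,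
    ← Finset.sum_sub_distrib, ← neg_eq_zero, ← this, ← Finset.sum_neg_distrib]
  refine Finset.sum_congr rfl fun k _ => ?_
  rw [hk]
  ring

end KoszulExact

section DeRham

variable {d : ℕ}

theorem polyT_apply (j : Fin d) (p : PolyA d) : polyT d (PolyA d) j p = MvPolynomial.X j * p := rfl

/-- The linear map multiplying the monomial `z^α` by `(|α| + c)⁻¹`. -/
def degInv (d c : ℕ) : PolyA d →ₗ[ℂ] PolyA d :=
  (MvPolynomial.basisMonomials (Fin d) ℂ).constr ℂ
    fun α => ((α.degree + c : ℕ) : ℂ)⁻¹ • MvPolynomial.monomial α 1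

theorem degInv_monomial (c : ℕ) (α : Fin d →₀ ℕ) (a : ℂ) :
    degInv d c (MvPolynomial.monomial α a) =
      ((α.degree + c : ℕ) : ℂ)⁻¹ • MvPolynomial.monomial α a := by
  have h := (MvPolynomial.basisMonomials (Fin d) ℂ).constr_basis ℂ
    (fun α => ((α.degree + c : ℕ) : ℂ)⁻¹ • MvPolynomial.monomial α (1 : ℂ)) α
  rw [MvPolynomial.coe_basisMonomials] at h
  have h1 : MvPolynomial.monomial α a = a • MvPolynomial.monomial α (1 : ℂ) := by
    rw [MvPolynomial.smul_monomial, smul_eq_mul, mul_one]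
  rw [h1, map_smul, degInv, h, smul_comm]

theorem X_mul_degInv (c : ℕ) (k : Fin d) (p : PolyA d) :
    MvPolynomial.X k * degInv d (c + 1) p = degInv d c (MvPolynomial.X k * p) := by
  induction p using MvPolynomial.induction_on' with
  | monomial α a =>
    rw [degInv_monomial, mul_smul_comm, MvPolynomial.X, MvPolynomial.monomial_mul,
      degInv_monomial, map_add, Finsupp.degree_single]
    congr 3
    ring
  | add p q hp hq => rw [map_add, mul_add, mul_add, map_add, hp, hq]

theorem euler_degInv (c : ℕ) (p : PolyA d) :
    ∑ k, MvPolynomial.X k * MvPolynomial.pderiv k (degInv d c p) + (c : ℂ) • degInv d c p =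
      p - if c = 0 then MvPolynomial.C (MvPolynomial.constantCoeff p) else 0 := by
  induction p using MvPolynomial.induction_on' with
  | monomial α a =>
    have h : ∑ k, MvPolynomial.X k * MvPolynomial.pderiv k (degInv d c (.monomial α a)) =
        (α.degree : ℂ) • degInv d c (.monomial α a) := by
      rw [degInv_monomial, Finsupp.degree_eq_sum, Nat.cast_sum, Finset.sum_smul]
      refine Finset.sum_congr rfl fun k _ => ?_
      rw [Derivation.map_smul, mul_smul_comm, MvPolynomial.X_mul_pderiv_monomial, smul_comm,
        Nat.cast_smul_eq_nsmul]
    rw [h, ← add_smul, ← Nat.cast_add, degInv_monomial, smul_smul]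
    by_cases h0 : α.degree + c = 0
    · obtain ⟨h1, rfl⟩ := Nat.add_eq_zero_iff.1 h0
      obtain rfl := (Finsupp.degree_eq_zero_iff α).1 h1
      simp
    · rw [mul_inv_cancel₀ (Nat.cast_ne_zero.2 h0), one_smul, eq_comm, sub_eq_self]
      split_ifs with hc
      · have : α ≠ 0 := by
          rintro rfl
          simp [hc] at h0
        rw [MvPolynomial.constantCoeff_monomial, if_neg this, map_zero]
      · rfl
  | add p q hp hq =>
    rw [map_add, smul_add, map_add, map_add]
    simp only [map_add, mul_add, Finset.sum_add_distrib]
    rw [add_add_add_comm, hp, hq]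
    split_ifs <;> ring

/-- The de Rham differential, contracting a form against the partial derivatives. -/
def kozD (d : ℕ) (f : Finset (Fin d) → PolyA d) : Finset (Fin d) → PolyA d := fun S =>
  ∑ j, if j ∈ S then 0 else kozSign S j • MvPolynomial.pderiv j (f (insert j S))

theorem kozD_mem_degSub {k : ℕ} {f : Finset (Fin d) → PolyA d} (hf : f ∈ degSub d (PolyA d) k) :
    kozD d f ∈ degSub d (PolyA d) (k - 1) := by
  intro S hS
  refine Finset.sum_eq_zero fun j _ => ?_
  split_ifs with hj
  · rfl
  · rw [hf, map_zero, smul_zero]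
    rw [Finset.card_insert_of_notMem hj]
    omega

theorem kozD_zero : kozD d 0 = 0 := by
  funext S
  simp [kozD]

theorem kozB_kozD_add (f : Finset (Fin d) → PolyA d) (S : Finset (Fin d)) :
    kozB d (polyT d (PolyA d)) (kozD d f) S + kozD d (kozB d (polyT d (PolyA d)) f) S =
      ∑ k, MvPolynomial.X k * MvPolynomial.pderiv k (f S) + ((d - S.card : ℕ) : ℂ) • f S := by
  let G : Fin d → Fin d → PolyA d := fun k j => if k ∈ S ∧ j ∉ S then
    (kozSign S k * kozSign (S.erase k) j) •
      (MvPolynomial.X k * MvPolynomial.pderiv j (f (insert j (S.erase k)))) else 0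
  have h1 : kozB d (polyT d (PolyA d)) (kozD d f) S = ∑ k, ((if k ∈ S then
      MvPolynomial.X k * MvPolynomial.pderiv k (f S) else 0) + ∑ j, G k j) := by
    rw [kozB_apply]
    refine Finset.sum_congr rfl fun k _ => ?_
    by_cases hk : k ∈ S
    · rw [if_pos hk, if_pos hk, polyT_apply, kozD, Finset.mul_sum, Finset.smul_sum,
        Fintype.sum_eq_add_sum_compl k, Fintype.sum_eq_add_sum_compl k (f := G k)]
      have hG : G k k = 0 := if_neg fun h => h.2 h.1
      rw [hG, zero_add]
      congr 1
      · rw [if_neg (Finset.notMem_erase k S), kozSign_erase hk, if_neg (lt_irrefl k),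
          mul_smul_comm, smul_smul, kozSign_mul_self, one_smul, Finset.insert_erase hk]
      · refine Finset.sum_congr rfl fun j hj => ?_
        have hj : j ≠ k := by simpa using hj
        by_cases hjS : j ∈ S
        · simp [G, hjS, hj]
        · rw [if_neg (by simp [hjS]), mul_smul_comm, smul_smul]
          exact (if_pos ⟨hk, hjS⟩).symm
    · simp [hk, G]
  have h2 : kozD d (kozB d (polyT d (PolyA d)) f) S = ∑ j, ((if j ∉ S then
      f S + MvPolynomial.X j * MvPolynomial.pderiv j (f S) else 0) - ∑ k, G k j) := by
    rw [kozD]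
    refine Finset.sum_congr rfl fun j _ => ?_
    by_cases hj : j ∈ S
    · simp [hj, G]
    · rw [if_neg hj, if_pos hj, kozB_apply, map_sum, Finset.smul_sum,
        Fintype.sum_eq_add_sum_compl j, Fintype.sum_eq_add_sum_compl j (f := fun k => G k j)]
      have hG : G j j = 0 := if_neg fun h => h.2 h.1
      rw [hG, zero_add, sub_eq_add_neg, ← Finset.sum_neg_distrib]
      congr 1
      · rw [if_pos (Finset.mem_insert_self j S), kozSign_insert hj, if_neg (lt_irrefl j),
          Derivation.map_smul, smul_smul, kozSign_mul_self, one_smul, Finset.erase_insert hj,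
          polyT_apply, Derivation.leibniz, MvPolynomial.pderiv_X_self, smul_eq_mul, smul_eq_mul,
          mul_one, add_comm]
      · refine Finset.sum_congr rfl fun k hk => ?_
        have hk : k ≠ j := by simpa using hk
        by_cases hkS : k ∈ S
        · rw [if_pos (by simp [hkS]), Derivation.map_smul, smul_smul, polyT_apply,
            Derivation.leibniz, MvPolynomial.pderiv_X_of_ne hk, smul_zero, add_zero,
            Finset.erase_insert_of_ne hk.symm, smul_eq_mul, eq_comm]
          refine (congrArg Neg.neg (if_pos ⟨hkS, hj⟩)).trans ?_
          rw [← neg_smul, kozSign_insert hj, kozSign_erase hkS]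
          congr 1
          rcases hk.lt_or_gt with h | h
          · rw [if_pos h, if_neg h.not_gt]; ring
          · rw [if_neg h.not_gt, if_pos h]; ring
        · simp [hkS, hk, G]
  have h3 : ((d - S.card : ℕ) : ℂ) • f S = ∑ j : Fin d, if j ∉ S then f S else 0 := by
    rw [Finset.sum_ite, Finset.sum_const_zero, add_zero, Finset.sum_const,
      Nat.cast_smul_eq_nsmul]
    congr 1
    rw [Finset.filter_not, Finset.filter_mem_eq_inter, Finset.univ_inter,
      Finset.card_sdiff_of_subset (Finset.subset_univ S), Finset.card_fin]
  rw [h1, h2, h3, Finset.sum_add_distrib, Finset.sum_sub_distrib,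
    Finset.sum_comm (f := fun j k => G k j), add_add_sub_cancel, ← Finset.sum_add_distrib,
    ← Finset.sum_add_distrib]
  refine Finset.sum_congr rfl fun k _ => ?_
  by_cases hk : k ∈ S <;> simp [hk, add_comm]

theorem kozB_degInv (f : Finset (Fin d) → PolyA d) (S : Finset (Fin d)) :
    kozB d (polyT d (PolyA d)) (fun S => degInv d (d - S.card) (f S)) S =
      degInv d (d - S.card) (kozB d (polyT d (PolyA d)) f S) := by
  rw [kozB_apply, kozB_apply, map_sum]
  refine Finset.sum_congr rfl fun k _ => ?_
  split_ifs with hk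
  · have h1 := Finset.card_erase_add_one hk
    have h2 : S.card ≤ d := by simpa using S.card_le_univ
    have h3 : d - (S.erase k).card = d - S.card + 1 := by omega
    rw [map_smul, polyT_apply, polyT_apply, h3, X_mul_degInv]
  · rw [map_zero]

theorem kozB_kozD_degInv {f : Finset (Fin d) → PolyA d}
    (hf : kozB d (polyT d (PolyA d)) f = 0) (S : Finset (Fin d)) :
    kozB d (polyT d (PolyA d)) (kozD d fun S => degInv d (d - S.card) (f S)) S =
      f S - if d - S.card = 0 then MvPolynomial.C (MvPolynomial.constantCoeff (f S)) else 0 := by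
  have h := kozB_kozD_add (fun S => degInv d (d - S.card) (f S)) S
  have h0 : kozB d (polyT d (PolyA d)) (fun S => degInv d (d - S.card) (f S)) = 0 := by
    funext S
    rw [kozB_degInv, hf]
    exact map_zero _
  rw [h0, kozD_zero, Pi.zero_apply, add_zero] at h
  rw [h, euler_degInv]

theorem mem_kozCob_polyA {k : ℕ} {f : Finset (Fin d) → PolyA d}
    (hf : f ∈ kozZ d (polyT d (PolyA d)) ⊤ k)
    (h : MvPolynomial.constantCoeff (f Finset.univ) = 0) :
    f ∈ kozCob d (polyT d (PolyA d)) ⊤ k := by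
  obtain ⟨hB, hdeg⟩ := mem_kozZ_top.1 hf
  refine mem_kozCob_top.2 ⟨_, kozD_mem_degSub fun S hS => ?_, funext fun S =>
    (kozB_kozD_degInv hB S).trans (sub_eq_self.2 ?_)⟩
  · rw [hdeg S hS, map_zero]
  · split_ifs with hS
    · have : S = Finset.univ := by
        rw [← Finset.card_eq_iff_eq_univ, Fintype.card_fin]
        have : S.card ≤ d := by simpa using S.card_le_univ
        omega
      rw [this, h, map_zero]
    · rfl

theorem subsingleton_kozH_polyA {k : ℕ} (hk : k < d) :
    Subsingleton (kozH d (polyT d (PolyA d)) ⊤ k) := by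
  refine Submodule.Quotient.subsingleton_iff.2 (eq_top_iff.2 fun z _ => mem_kozCob_polyA z.2 ?_)
  rw [Submodule.subtype_apply, (mem_kozZ_top.1 z.2).2 _ (by rw [Finset.card_fin]; exact hk.ne'),
    map_zero]

theorem constantCoeff_kozB (f : Finset (Fin d) → PolyA d) (S : Finset (Fin d)) :
    MvPolynomial.constantCoeff (kozB d (polyT d (PolyA d)) f S) = 0 := by
  rw [kozB_apply, map_sum]
  refine Finset.sum_eq_zero fun k _ => ?_
  split_ifs
  · simp [polyT_apply]
  · rw [map_zero]

/-- The top Koszul cohomology of `ℂ[z₁,…,z_d]` is `ℂ`. -/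
theorem nonempty_kozH_polyA_equiv (d : ℕ) :
    Nonempty (kozH d (polyT d (PolyA d)) ⊤ d ≃ₗ[ℂ] ℂ) := by
  let F : kozZ d (polyT d (PolyA d)) ⊤ d →ₗ[ℂ] ℂ :=
    MvPolynomial.lcoeff ℂ 0 ∘ₗ LinearMap.proj Finset.univ ∘ₗ Submodule.subtype _
  have hF (z) : F z = MvPolynomial.constantCoeff (z.1 Finset.univ) := rfl
  have hsurj : Function.Surjective F := by
    intro a
    have hdeg : Pi.single Finset.univ (MvPolynomial.C a) ∈ degSub d (PolyA d) d := by
      intro S hS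
      refine Pi.single_eq_of_ne ?_ _
      rintro rfl
      exact hS (Finset.card_fin d)
    refine ⟨⟨Pi.single Finset.univ (MvPolynomial.C a), mem_kozZ_top.2 ⟨?_, hdeg⟩⟩, ?_⟩
    · exact eq_zero_of_mem_degSub (Nat.lt_succ_self d) (kozB_mem_degSub hdeg)
    · exact (congrArg MvPolynomial.constantCoeff
        (Pi.single_eq_same (M := fun _ => PolyA d) Finset.univ _)).trans (MvPolynomial.constantCoeff_C _ a)
  have hker : Submodule.comap (kozZ d (polyT d (PolyA d)) ⊤ d).subtype
      (kozCob d (polyT d (PolyA d)) ⊤ d) = LinearMap.ker F := by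
    ext z
    rw [LinearMap.mem_ker, hF]
    constructor
    · intro h
      obtain ⟨g, _, hg⟩ := mem_kozCob_top.1 h
      rw [show z.1 = _ from hg.symm, constantCoeff_kozB]
    · exact mem_kozCob_polyA z.2
  exact ⟨(Submodule.quotEquivOfEq _ _ hker).trans (F.quotKerEquivOfSurjective hsurj)⟩

theorem modFiniteType_polyA (d : ℕ) : ModFiniteType d (PolyA d) := by
  intro k hk
  rcases hk.lt_or_eq with hk | rfl
  · have := subsingleton_kozH_polyA hk
    infer_instance
  · obtain ⟨e⟩ := nonempty_kozH_polyA_equiv k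
    exact Module.Finite.equiv e.symm

theorem modEuler_polyA (d : ℕ) : modEuler d (PolyA d) = (-1) ^ d := by
  obtain ⟨e⟩ := nonempty_kozH_polyA_equiv d
  rw [modEuler, eulerNum, Finset.sum_range_succ, e.finrank_eq, Module.finrank_self, Nat.cast_one,
    mul_one, add_eq_right]
  refine Finset.sum_eq_zero fun k hk => ?_
  have := subsingleton_kozH_polyA (Finset.mem_range.1 hk)
  rw [Module.finrank_zero_of_subsingleton, Nat.cast_zero, mul_zero]

end DeRham

section ResolutionKernel

variable {d : ℕ} {M : Type*} [AddCommGroup M] [Module (PolyA d) M]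

theorem IsFreeResolution.ker {n : ℕ} {r : ℕ → ℕ}
    {δ : ∀ k : ℕ, (Fin (r (k + 2)) → PolyA d) →ₗ[PolyA d] (Fin (r (k + 1)) → PolyA d)}
    {ε : (Fin (r 1) → PolyA d) →ₗ[PolyA d] M} (h : IsFreeResolution d M (n + 1) r δ ε) :
    IsFreeResolution d (LinearMap.ker ε) n (fun k => r (k + 1)) (fun k => δ (k + 1))
      ((δ 0).codRestrict (LinearMap.ker ε) fun x => h.2.1 ▸ LinearMap.mem_range_self (δ 0) x) := by
  obtain ⟨_, hδ0, hδ, hr⟩ := h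
  refine ⟨?_, ?_, fun k => hδ (k + 1), fun k hk => hr (k + 1) (by omega)⟩
  · rintro ⟨y, hy⟩
    rw [← hδ0] at hy
    obtain ⟨x, rfl⟩ := hy
    exact ⟨x, rfl⟩
  · rw [LinearMap.ker_codRestrict]
    exact hδ 0

theorem IsFreeResolution.subsingleton {r : ℕ → ℕ}
    {δ : ∀ k : ℕ, (Fin (r (k + 2)) → PolyA d) →ₗ[PolyA d] (Fin (r (k + 1)) → PolyA d)}
    {ε : (Fin (r 1) → PolyA d) →ₗ[PolyA d] M} (h : IsFreeResolution d M 0 r δ ε) :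
    Subsingleton M := by
  have : IsEmpty (Fin (r 1)) := by
    rw [h.2.2.2 1 one_pos]
    infer_instance
  exact h.1.subsingleton

theorem resChi_succ (n : ℕ) (r : ℕ → ℕ) :
    resChi (n + 1) r = r 1 - resChi n fun k => r (k + 1) := by
  induction n with
  | zero => simp [resChi]
  | succ n ih =>
    rw [resChi, Finset.sum_Icc_succ_top (by omega), ← resChi, ih, resChi, resChi,
      Finset.sum_Icc_succ_top (by omega)]
    ring

end ResolutionKernel

section Assembly

theorem KozFiniteType.extension {d : ℕ} {V' V V'' : Type*} [AddCommGroup V'] [Module ℂ V']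
    [AddCommGroup V] [Module ℂ V] [AddCommGroup V''] [Module ℂ V'']
    {T' : Fin d → V' →ₗ[ℂ] V'} {T : Fin d → V →ₗ[ℂ] V} {T'' : Fin d → V'' →ₗ[ℂ] V''}
    {φ : V' →ₗ[ℂ] V} {ψ : V →ₗ[ℂ] V''} (hT : ∀ i j x, T i (T j x) = T j (T i x))
    (hφ : ∀ i x, φ (T' i x) = T i (φ x)) (hψ : ∀ i x, ψ (T i x) = T'' i (ψ x))
    (hinj : Function.Injective φ) (hex : Function.Exact φ ψ) (hsurj : Function.Surjective ψ)
    (h' : KozFiniteType d T' ⊤) (h'' : KozFiniteType d T'' ⊤) : KozFiniteType d T ⊤ := by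
  intro k hk
  have := h' k hk
  have := h'' k hk
  have : Module.Finite ℂ (LinearMap.range (kozMap hφ k)) := inferInstance
  have hK := (kozMap_exact hT hφ hψ hinj hex hsurj k).linearMap_ker_eq
  rw [← hK] at this
  have : Module.Finite ℂ (kozH d T ⊤ k ⧸ LinearMap.ker (kozMap hψ k)) :=
    Module.Finite.equiv (kozMap hψ k).quotKerEquivRange.symm
  exact Module.Finite.of_submodule_quotient (LinearMap.ker (kozMap hψ k))

variable {d : ℕ} {M' M M'' : Type*} [AddCommGroup M'] [Module ℂ M'] [Module (PolyA d) M']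
  [IsScalarTower ℂ (PolyA d) M'] [AddCommGroup M] [Module ℂ M] [Module (PolyA d) M]
  [IsScalarTower ℂ (PolyA d) M] [AddCommGroup M''] [Module ℂ M''] [Module (PolyA d) M'']
  [IsScalarTower ℂ (PolyA d) M'']

theorem polyT_comm (i j : Fin d) (x : M) :
    polyT d M i (polyT d M j x) = polyT d M j (polyT d M i x) :=
  smul_comm (MvPolynomial.X i : PolyA d) (MvPolynomial.X j : PolyA d) x

theorem restrictScalars_polyT (φ : M' →ₗ[PolyA d] M) (i : Fin d) (x : M') :
    φ.restrictScalars ℂ (polyT d M' i x) = polyT d M i (φ.restrictScalars ℂ x) :=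
  φ.map_smul (MvPolynomial.X i) x

variable {φ : M' →ₗ[PolyA d] M} {ψ : M →ₗ[PolyA d] M''}

theorem ModFiniteType.extension (hinj : Function.Injective φ) (hex : Function.Exact φ ψ)
    (hsurj : Function.Surjective ψ) (h' : ModFiniteType d M') (h'' : ModFiniteType d M'') :
    ModFiniteType d M :=
  KozFiniteType.extension polyT_comm (restrictScalars_polyT φ) (restrictScalars_polyT ψ) hinj hex
    hsurj h' h''

theorem ModFiniteType.of_exact (hinj : Function.Injective φ) (hex : Function.Exact φ ψ)
    (hsurj : Function.Surjective ψ) (h' : ModFiniteType d M') (h : ModFiniteType d M) :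
    ModFiniteType d M'' :=
  KozFiniteType.of_exact polyT_comm (restrictScalars_polyT φ) (restrictScalars_polyT ψ) hinj hex
    hsurj h' h

theorem modEuler_of_exact (hinj : Function.Injective φ) (hex : Function.Exact φ ψ)
    (hsurj : Function.Surjective ψ) (h' : ModFiniteType d M') (h : ModFiniteType d M) :
    modEuler d M = modEuler d M' + modEuler d M'' :=
  eulerNum_of_exact polyT_comm (restrictScalars_polyT φ) (restrictScalars_polyT ψ) hinj hex
    hsurj h' h

theorem subsingleton_kozH_of_subsingleton [Subsingleton M] (k : ℕ) :
    Subsingleton (kozH d (polyT d M) ⊤ k) :=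
  Function.Surjective.subsingleton (kozCls_surjective (T := polyT d M) k)

theorem modFiniteType_of_subsingleton [Subsingleton M] : ModFiniteType d M := by
  intro k _
  have := subsingleton_kozH_of_subsingleton (d := d) (M := M) k
  infer_instance

theorem modEuler_of_subsingleton [Subsingleton M] : modEuler d M = 0 := by
  rw [modEuler, eulerNum]
  refine Finset.sum_eq_zero fun k _ => ?_
  have := subsingleton_kozH_of_subsingleton (d := d) (M := M) k
  rw [Module.finrank_zero_of_subsingleton, Nat.cast_zero, mul_zero]

theorem modFiniteType_and_modEuler_free (d r : ℕ) :
    ModFiniteType d (Fin r → PolyA d) ∧ modEuler d (Fin r → PolyA d) = r * (-1) ^ d := by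
  induction r with
  | zero => exact ⟨modFiniteType_of_subsingleton, by simp [modEuler_of_subsingleton]⟩
  | succ r ih =>
    let φ : PolyA d →ₗ[PolyA d] (Fin (r + 1) → PolyA d) :=
      LinearMap.single (PolyA d) (fun _ : Fin (r + 1) => PolyA d) 0
    let ψ : (Fin (r + 1) → PolyA d) →ₗ[PolyA d] (Fin r → PolyA d) :=
      LinearMap.funLeft (PolyA d) _ Fin.succ
    have hinj : Function.Injective φ := Pi.single_injective (M := fun _ => PolyA d) 0
    have hsurj : Function.Surjective ψ :=
      LinearMap.funLeft_surjective_of_injective _ _ _ (Fin.succ_injective r)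
    have hex : Function.Exact φ ψ := by
      intro f
      constructor
      · intro hf
        refine ⟨f 0, funext fun i => ?_⟩
        rcases Fin.eq_zero_or_eq_succ i with rfl | ⟨j, rfl⟩
        · exact Pi.single_eq_same (M := fun _ : Fin (r + 1) => PolyA d) 0 _
        · exact (Pi.single_eq_of_ne (M := fun _ => PolyA d) (Fin.succ_ne_zero j) (f 0)).trans
            (congrFun hf j).symm
      · rintro ⟨a, rfl⟩
        exact funext fun j => Pi.single_eq_of_ne (M := fun _ => PolyA d) (Fin.succ_ne_zero j) a
    have hA := modFiniteType_polyA d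
    have hM := ModFiniteType.extension hinj hex hsurj hA ih.1
    refine ⟨hM, ?_⟩
    rw [modEuler_of_exact hinj hex hsurj hA hM, modEuler_polyA, ih.2]
    push_cast
    ring

theorem modFiniteType_and_modEuler_of_surjective {m : ℕ} (φ : (Fin m → PolyA d) →ₗ[PolyA d] M)
    (hφ : Function.Surjective φ) (hK : ModFiniteType d (LinearMap.ker φ)) :
    ModFiniteType d M ∧ modEuler d M = (-1) ^ d * m - modEuler d (LinearMap.ker φ) := by
  obtain ⟨hF, hF'⟩ := modFiniteType_and_modEuler_free d m
  have hinj : Function.Injective (LinearMap.ker φ).subtype := Submodule.subtype_injective _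
  have hex : Function.Exact (LinearMap.ker φ).subtype φ := LinearMap.exact_subtype_ker_map φ
  refine ⟨hK.of_exact hinj hex hφ hF, ?_⟩
  have := modEuler_of_exact hinj hex hφ hK hF
  rw [hF'] at this
  rw [eq_sub_iff_add_eq, mul_comm, this, add_comm]

theorem IsFreeResolution.modFiniteType_and_modEuler_of_ker {n : ℕ} {r : ℕ → ℕ}
    {δ : ∀ k : ℕ, (Fin (r (k + 2)) → PolyA d) →ₗ[PolyA d] (Fin (r (k + 1)) → PolyA d)}
    {ε : (Fin (r 1) → PolyA d) →ₗ[PolyA d] M} (h : IsFreeResolution d M (n + 1) r δ ε)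
    (hK : ModFiniteType d (LinearMap.ker ε) ∧
      modEuler d (LinearMap.ker ε) = (-1) ^ d * resChi n fun k => r (k + 1)) :
    ModFiniteType d M ∧ modEuler d M = (-1) ^ d * resChi (n + 1) r := by
  obtain ⟨h1, h2⟩ := modFiniteType_and_modEuler_of_surjective ε h.1 hK.1
  refine ⟨h1, ?_⟩
  rw [h2, hK.2, resChi_succ, mul_sub]

/-- The case of a module in `Type`, to which the general one is reduced by passing to the kernel
of the augmentation. -/
theorem IsFreeResolution.modFiniteType_and_modEuler_aux {n : ℕ} :
    ∀ {M : Type} [AddCommGroup M] [Module ℂ M] [Module (PolyA d) M] [IsScalarTower ℂ (PolyA d) M]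
    {r : ℕ → ℕ}
    {δ : ∀ k : ℕ, (Fin (r (k + 2)) → PolyA d) →ₗ[PolyA d] (Fin (r (k + 1)) → PolyA d)}
    {ε : (Fin (r 1) → PolyA d) →ₗ[PolyA d] M}, IsFreeResolution d M n r δ ε →
    ModFiniteType d M ∧ modEuler d M = (-1) ^ d * resChi n r := by
  induction n with
  | zero =>
    intro M _ _ _ _ r δ ε h
    have := h.subsingleton
    exact ⟨modFiniteType_of_subsingleton, by simp [modEuler_of_subsingleton, resChi]⟩
  | succ n ih =>
    intro M _ _ _ _ r δ ε h
    exact h.modFiniteType_and_modEuler_of_ker (ih h.ker)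

theorem IsFreeResolution.modFiniteType_and_modEuler {n : ℕ} {r : ℕ → ℕ}
    {δ : ∀ k : ℕ, (Fin (r (k + 2)) → PolyA d) →ₗ[PolyA d] (Fin (r (k + 1)) → PolyA d)}
    {ε : (Fin (r 1) → PolyA d) →ₗ[PolyA d] M} (h : IsFreeResolution d M n r δ ε) :
    ModFiniteType d M ∧ modEuler d M = (-1) ^ d * resChi n r := by
  rcases n with _ | n
  · have := h.subsingleton
    exact ⟨modFiniteType_of_subsingleton, by simp [modEuler_of_subsingleton, resChi]⟩
  · exact h.modFiniteType_and_modEuler_of_ker h.ker.modFiniteType_and_modEuler_aux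

end Assembly

/-- **Lemma 2.** Every finitely generated module `M` over `ℂ[z₁,…,z_d]` is
of finite type; finite free resolutions of `M` exist, and for any finite free resolution
`0 → F_n → ⋯ → F₁ → M → 0` one has `e(M) = (-1)^d Σ_{k=1}^n (-1)^{k+1} rank F_k`, i.e.
`e(M) = (-1)^d χ(M)`. -/
theorem arveson_stmt16 {d : ℕ} {M : Type*} [AddCommGroup M] [Module ℂ M]
    [Module (PolyA d) M] [IsScalarTower ℂ (PolyA d) M] [Module.Finite (PolyA d) M] :
    ModFiniteType d M ∧
    (∃ (n : ℕ) (r : ℕ → ℕ)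
        (δ : ∀ k : ℕ, (Fin (r (k + 2)) → PolyA d) →ₗ[PolyA d] (Fin (r (k + 1)) → PolyA d))
        (ε : (Fin (r 1) → PolyA d) →ₗ[PolyA d] M), IsFreeResolution d M n r δ ε) ∧
    ∀ (n : ℕ) (r : ℕ → ℕ)
      (δ : ∀ k : ℕ, (Fin (r (k + 2)) → PolyA d) →ₗ[PolyA d] (Fin (r (k + 1)) → PolyA d))
      (ε : (Fin (r 1) → PolyA d) →ₗ[PolyA d] M), IsFreeResolution d M n r δ ε →
        modEuler d M = (-1 : ℤ) ^ d * resChi n r := by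
  obtain ⟨n, r, δ, ε, h⟩ := exists_isFreeResolution d M
  exact ⟨h.modFiniteType_and_modEuler.1, ⟨n, r, δ, ε, h⟩,
    fun n r δ ε h => h.modFiniteType_and_modEuler.2⟩

end
end
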